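/- Completeness of the axiom system E_SP for the SP semantics (Theorem 1): for all SAND attack trees t and t', ⟦t⟧ = ⟦t'⟧ if and only if the equation t = t' is a syntactic consequence of E_SP. -/

import Mathlib

/-!
Formalization of "Attack Trees with Sequential Conjunction".

Source-sink graphs over a set `B` of basic actions: a vertex type `V`,
a multiset of labeled edges, a source `s` and a sink `z` with `s ≠ z`.
-/

structure SSG (B : Type) : Type 1 where
  V : Type
  deq : DecidableEq V
  E : Multiset (V × B × V)
  s : V
  z : V
  ne : s ≠ z

namespace SSG

variable {B : Type}

/-- The graph with a single edge labeled `b`. -/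
def single (b : B) : SSG B where
  V := Bool
  deq := inferInstance
  E := {(false, b, true)}
  s := false
  z := true
  ne := Bool.false_ne_true

/-- In the sequential composition, the sink of the first graph is identified with
the source of the second graph. -/
def seqEmbed (G G' : SSG B) (v : G.V) : ({u : G.V // u ≠ G.z} ⊕ G'.V) :=
  haveI := G.deq
  if h : v = G.z then Sum.inr G'.s else Sum.inl ⟨v, h⟩

/-- Sequential composition `G ⋅ G'` of source-sink graphs: the disjoint union in which
the sink of `G` is identified with the source of `G'`. -/
def seq (G G' : SSG B) : SSG B where
  V := {u : G.V // u ≠ G.z} ⊕ G'.V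
  deq := by haveI := G.deq; haveI := G'.deq; infer_instance
  E := G.E.map (fun e => (G.seqEmbed G' e.1, e.2.1, G.seqEmbed G' e.2.2)) +
       G'.E.map (fun e => (Sum.inr e.1, e.2.1, Sum.inr e.2.2))
  s := Sum.inl ⟨G.s, G.ne⟩
  z := Sum.inr G'.z
  ne := by simp

/-- In the parallel composition, the two sources are identified and the two sinks
are identified. -/
def parEmbed (G G' : SSG B) (v : G.V) : ({u : G.V // u ≠ G.s ∧ u ≠ G.z} ⊕ G'.V) :=
  haveI := G.deq
  if hs : v = G.s then Sum.inr G'.s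
  else if hz : v = G.z then Sum.inr G'.z
  else Sum.inl ⟨v, hs, hz⟩

/-- Parallel composition `G ∥ G'` of source-sink graphs: the disjoint union in which
the two sources are identified and the two sinks are identified. -/
def par (G G' : SSG B) : SSG B where
  V := {u : G.V // u ≠ G.s ∧ u ≠ G.z} ⊕ G'.V
  deq := by haveI := G.deq; haveI := G'.deq; infer_instance
  E := G.E.map (fun e => (G.parEmbed G' e.1, e.2.1, G.parEmbed G' e.2.2)) +
       G'.E.map (fun e => (Sum.inr e.1, e.2.1, Sum.inr e.2.2))
  s := Sum.inr G'.s
  z := Sum.inr G'.z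
  ne := fun h => G'.ne (Sum.inr_injective h)

/-- Two source-sink graphs are equal (isomorphic) if there is a bijection between their
vertex sets that preserves the labeled edges (and hence source and sink). -/
def Iso (G G' : SSG B) : Prop :=
  ∃ f : G.V ≃ G'.V,
    G.E.map (fun e => (f e.1, e.2.1, f e.2.2)) = G'.E ∧ f G.s = G'.s ∧ f G.z = G'.z

/-- Directed adjacency: there is an edge from `u` to `v`. -/
def Adj (G : SSG B) (u v : G.V) : Prop := ∃ b, (u, b, v) ∈ G.E

/-- Series-parallel graphs (SP graphs): built from single edges by sequential and
parallel composition; as SP graphs are considered up to isomorphism, the collection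
is closed under isomorphism. -/
inductive IsSP : SSG B → Prop
  | single (b : B) : IsSP (single b)
  | seq {G G' : SSG B} : IsSP G → IsSP G' → IsSP (G.seq G')
  | par {G G' : SSG B} : IsSP G → IsSP G' → IsSP (G.par G')
  | iso {G G' : SSG B} : IsSP G → G.Iso G' → IsSP G'

/-- A graph is connected if any two vertices are joined by a path in the
underlying undirected graph. -/
def Connected (G : SSG B) : Prop :=
  ∀ u v : G.V, Relation.ReflTransGen (fun a b => G.Adj a b ∨ G.Adj b a) u v

/-- A directed graph is acyclic if it has no (nonempty) directed cycle. -/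
def Acyclic (G : SSG B) : Prop := ∀ v : G.V, ¬ Relation.TransGen G.Adj v v

end SSG
/-!
SAND attack trees: closed terms over `B ∪ {OR, AND, SAND}`, where the unranked
operators take `k ≥ 1` arguments (represented by nonempty lists `SandTreeList`).
-/

mutual
inductive SandTree (B : Type) : Type
  | atom : B → SandTree B
  | or : SandTreeList B → SandTree B
  | and : SandTreeList B → SandTree B
  | sand : SandTreeList B → SandTree B
inductive SandTreeList (B : Type) : Type
  | single : SandTree B → SandTreeList B
  | cons : SandTree B → SandTreeList B → SandTreeList B
end

namespace SandTreeList

variable {B : Type}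

def toList : SandTreeList B → List (SandTree B)
  | .single t => [t]
  | .cons t ts => t :: ts.toList

/-- Prepend a (possibly empty) list of trees to a nonempty argument list. -/
def glue : List (SandTree B) → SandTreeList B → SandTreeList B
  | [], ys => ys
  | x :: xs, ys => .cons x (glue xs ys)

/-- The nonempty argument list `t :: l`. -/
def ofList : SandTree B → List (SandTree B) → SandTreeList B
  | t, [] => .single t
  | t, u :: us => .cons t (ofList u us)

/-- Append a (possibly empty) list of trees to a nonempty argument list. -/
def snoc : SandTreeList B → List (SandTree B) → SandTreeList B
  | .single t, zs => ofList t zs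
  | .cons t ts, zs => .cons t (snoc ts zs)

def map (f : SandTree B → SandTree B) : SandTreeList B → SandTreeList B
  | .single t => .single (f t)
  | .cons t ts => .cons (f t) (map f ts)

end SandTreeList

/-!
The SP semantics `sem` interprets a SAND attack tree as a set of SP graphs
(sets of source-sink graphs closed under isomorphism, since SP graphs are
considered up to isomorphism):
`⟦b⟧ = {→b}`, `⟦OR(t₁,…,t_k)⟧ = ⋃ᵢ ⟦tᵢ⟧`,
`⟦AND(t₁,…,t_k)⟧ = {G₁ ∥ … ∥ G_k | Gᵢ ∈ ⟦tᵢ⟧}`,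
`⟦SAND(t₁,…,t_k)⟧ = {G₁ ⋅ … ⋅ G_k | Gᵢ ∈ ⟦tᵢ⟧}`.
-/

mutual
def sem {B : Type} : SandTree B → Set (SSG B)
  | .atom b => {G | (SSG.single b).Iso G}
  | .or ts => semOr ts
  | .and ts => semAnd ts
  | .sand ts => semSand ts
def semOr {B : Type} : SandTreeList B → Set (SSG B)
  | .single t => sem t
  | .cons t ts => sem t ∪ semOr ts
def semAnd {B : Type} : SandTreeList B → Set (SSG B)
  | .single t => sem t
  | .cons t ts => {G | ∃ G1 ∈ sem t, ∃ G2 ∈ semAnd ts, (G1.par G2).Iso G}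
def semSand {B : Type} : SandTreeList B → Set (SSG B)
  | .single t => sem t
  | .cons t ts => {G | ∃ G1 ∈ sem t, ∃ G2 ∈ semSand ts, (G1.seq G2).Iso G}
end
/-!
Equality of terms modulo commutativity of the unranked operators `OR` and `AND`
(the congruence generated by permuting the arguments of `OR` and `AND` nodes).
-/

mutual
inductive PEq {B : Type} : SandTree B → SandTree B → Prop
  | refl (t : SandTree B) : PEq t t
  | symm {t u : SandTree B} : PEq t u → PEq u t
  | trans {t u v : SandTree B} : PEq t u → PEq u v → PEq t v
  | orPerm {ts ts' : SandTreeList B} : ts.toList.Perm ts'.toList → PEq (.or ts) (.or ts')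
  | andPerm {ts ts' : SandTreeList B} : ts.toList.Perm ts'.toList → PEq (.and ts) (.and ts')
  | orCongr {ts ts' : SandTreeList B} : PEqL ts ts' → PEq (.or ts) (.or ts')
  | andCongr {ts ts' : SandTreeList B} : PEqL ts ts' → PEq (.and ts) (.and ts')
  | sandCongr {ts ts' : SandTreeList B} : PEqL ts ts' → PEq (.sand ts) (.sand ts')
inductive PEqL {B : Type} : SandTreeList B → SandTreeList B → Prop
  | single {t t' : SandTree B} : PEq t t' → PEqL (.single t) (.single t')
  | cons {t t' : SandTree B} {ts ts' : SandTreeList B} :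
      PEq t t' → PEqL ts ts' → PEqL (.cons t ts) (.cons t' ts')
end
/-!
Syntactic consequence from the axiom system `E_SP`.

The axiom schemes are represented by all of their instances (arbitrary argument
terms in place of the variable vectors `X⃗`, `Y⃗`, `Z⃗`); on closed terms this
generates exactly the same derivability relation as variables plus the
substitution rule.  Closure under "replacement in contexts" is represented by
the congruence rules for the three operators.
-/

section
open SandTreeList
mutual
inductive DerivSP {B : Type} : SandTree B → SandTree B → Prop
  /- closure rules -/
  | refl (t : SandTree B) : DerivSP t t
  | symm {t u : SandTree B} : DerivSP t u → DerivSP u t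
  | trans {t u v : SandTree B} : DerivSP t u → DerivSP u v → DerivSP t v
  | congrOr {ts ts' : SandTreeList B} : DerivSPL ts ts' → DerivSP (.or ts) (.or ts')
  | congrAnd {ts ts' : SandTreeList B} : DerivSPL ts ts' → DerivSP (.and ts) (.and ts')
  | congrSand {ts ts' : SandTreeList B} : DerivSPL ts ts' → DerivSP (.sand ts) (.sand ts')
  /- (E1) commutativity of OR -/
  | ax1 {ts ts' : SandTreeList B} : ts.toList.Perm ts'.toList → DerivSP (.or ts) (.or ts')
  /- (E2) commutativity of AND -/
  | ax2 {ts ts' : SandTreeList B} : ts.toList.Perm ts'.toList → DerivSP (.and ts) (.and ts')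
  /- (E3) OR(X⃗, OR(Y⃗)) = OR(X⃗, Y⃗) -/
  | ax3 (xs : List (SandTree B)) (ys : SandTreeList B) :
      DerivSP (.or (glue xs (.single (.or ys)))) (.or (glue xs ys))
  /- (E4) AND(X⃗, AND(Y⃗)) = AND(X⃗, Y⃗) -/
  | ax4 (xs : List (SandTree B)) (ys : SandTreeList B) :
      DerivSP (.and (glue xs (.single (.and ys)))) (.and (glue xs ys))
  /- (E4') SAND(X⃗, SAND(Y⃗), Z⃗) = SAND(X⃗, Y⃗, Z⃗) -/
  | ax4' (xs : List (SandTree B)) (ys : SandTreeList B) (zs : List (SandTree B)) :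
      DerivSP (.sand (glue xs (snoc (.single (.sand ys)) zs))) (.sand (glue xs (snoc ys zs)))
  /- (E5) OR(A) = A -/
  | ax5 (t : SandTree B) : DerivSP (.or (.single t)) t
  /- (E6) AND(A) = A -/
  | ax6 (t : SandTree B) : DerivSP (.and (.single t)) t
  /- (E6') SAND(A) = A -/
  | ax6' (t : SandTree B) : DerivSP (.sand (.single t)) t
  /- (E10) AND(X⃗, OR(Y⃗)) = OR(AND(X⃗,Y₁),…,AND(X⃗,Yₗ)) -/
  | ax10 (xs : List (SandTree B)) (ys : SandTreeList B) :
      DerivSP (.and (glue xs (.single (.or ys))))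
        (.or (SandTreeList.map (fun y => .and (glue xs (.single y))) ys))
  /- (E10') SAND(X⃗, OR(Y⃗), Z⃗) = OR(SAND(X⃗,Y₁,Z⃗),…,SAND(X⃗,Yₗ,Z⃗)) -/
  | ax10' (xs : List (SandTree B)) (ys : SandTreeList B) (zs : List (SandTree B)) :
      DerivSP (.sand (glue xs (snoc (.single (.or ys)) zs)))
        (.or (SandTreeList.map (fun y => .sand (glue xs (snoc (.single y) zs))) ys))
  /- (E11) OR(A, A, X⃗) = OR(A, X⃗) -/
  | ax11 (a : SandTree B) (xs : List (SandTree B)) :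
      DerivSP (.or (.cons a (ofList a xs))) (.or (ofList a xs))
inductive DerivSPL {B : Type} : SandTreeList B → SandTreeList B → Prop
  | single {t t' : SandTree B} : DerivSP t t' → DerivSPL (.single t) (.single t')
  | cons {t t' : SandTree B} {ts ts' : SandTreeList B} :
      DerivSP t t' → DerivSPL ts ts' → DerivSPL (.cons t ts) (.cons t' ts')
end
end

/-! Syntactic consequence from the SAND-free fragment
`E_SM = {E1, E2, E3, E4, E5, E6, E10, E11}` of `E_SP` (formulated over the full
signature of SAND attack trees). -/
section
open SandTreeList
mutual
inductive DerivSM {B : Type} : SandTree B → SandTree B → Prop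
  | refl (t : SandTree B) : DerivSM t t
  | symm {t u : SandTree B} : DerivSM t u → DerivSM u t
  | trans {t u v : SandTree B} : DerivSM t u → DerivSM u v → DerivSM t v
  | congrOr {ts ts' : SandTreeList B} : DerivSML ts ts' → DerivSM (.or ts) (.or ts')
  | congrAnd {ts ts' : SandTreeList B} : DerivSML ts ts' → DerivSM (.and ts) (.and ts')
  | congrSand {ts ts' : SandTreeList B} : DerivSML ts ts' → DerivSM (.sand ts) (.sand ts')
  | ax1 {ts ts' : SandTreeList B} : ts.toList.Perm ts'.toList → DerivSM (.or ts) (.or ts')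
  | ax2 {ts ts' : SandTreeList B} : ts.toList.Perm ts'.toList → DerivSM (.and ts) (.and ts')
  | ax3 (xs : List (SandTree B)) (ys : SandTreeList B) :
      DerivSM (.or (glue xs (.single (.or ys)))) (.or (glue xs ys))
  | ax4 (xs : List (SandTree B)) (ys : SandTreeList B) :
      DerivSM (.and (glue xs (.single (.and ys)))) (.and (glue xs ys))
  | ax5 (t : SandTree B) : DerivSM (.or (.single t)) t
  | ax6 (t : SandTree B) : DerivSM (.and (.single t)) t
  | ax10 (xs : List (SandTree B)) (ys : SandTreeList B) :
      DerivSM (.and (glue xs (.single (.or ys))))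
        (.or (SandTreeList.map (fun y => .and (glue xs (.single y))) ys))
  | ax11 (a : SandTree B) (xs : List (SandTree B)) :
      DerivSM (.or (.cons a (ofList a xs))) (.or (ofList a xs))
inductive DerivSML {B : Type} : SandTreeList B → SandTreeList B → Prop
  | single {t t' : SandTree B} : DerivSM t t' → DerivSML (.single t) (.single t')
  | cons {t t' : SandTree B} {ts ts' : SandTreeList B} :
      DerivSM t t' → DerivSML ts ts' → DerivSML (.cons t ts) (.cons t' ts')
end
end
/-!
The normal-form grammar (for `k ≥ 2`, `b ∈ B`):
`N ::= A | OR(A₁,…,A_k)` (with pairwise distinct `Aᵢ`),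
`A ::= C | S`, `C ::= b | AND(S₁,…,S_k)`, `S ::= b | SAND(C₁,…,C_k)`.
-/

mutual
inductive IsC {B : Type} : SandTree B → Prop
  | atom (b : B) : IsC (.atom b)
  | and {ts : SandTreeList B} : 2 ≤ ts.toList.length → IsSL ts → IsC (.and ts)
inductive IsS {B : Type} : SandTree B → Prop
  | atom (b : B) : IsS (.atom b)
  | sand {ts : SandTreeList B} : 2 ≤ ts.toList.length → IsCL ts → IsS (.sand ts)
inductive IsSL {B : Type} : SandTreeList B → Prop
  | single {t : SandTree B} : IsS t → IsSL (.single t)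
  | cons {t : SandTree B} {ts : SandTreeList B} : IsS t → IsSL ts → IsSL (.cons t ts)
inductive IsCL {B : Type} : SandTreeList B → Prop
  | single {t : SandTree B} : IsC t → IsCL (.single t)
  | cons {t : SandTree B} {ts : SandTreeList B} : IsC t → IsCL ts → IsCL (.cons t ts)
end

/-- Terms generated by the non-terminal `A` of the normal-form grammar. -/
def IsA {B : Type} (t : SandTree B) : Prop := IsC t ∨ IsS t

/-- Terms generated by the non-terminal `N` of the normal-form grammar; as terms
are considered modulo commutativity of `OR` and `AND`, the arguments of the `OR`
are required to be pairwise distinct modulo commutativity. -/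
def IsN {B : Type} (t : SandTree B) : Prop :=
  IsA t ∨ ∃ ts : SandTreeList B, t = .or ts ∧ 2 ≤ ts.toList.length ∧
    (∀ u ∈ ts.toList, IsA u) ∧ ts.toList.Pairwise (fun a b => ¬ PEq a b)

/-!
The term rewriting system obtained by orienting the axioms
(E3), (E4), (E4'), (E5), (E6), (E6'), (E10), (E10'), (E11) from left to right,
applied in any context, modulo commutativity of `OR` and `AND`.
-/

section
open SandTreeList

/-- Rule application at the root. -/
inductive RStep {B : Type} : SandTree B → SandTree B → Prop
  | r3 (xs : List (SandTree B)) (ys : SandTreeList B) :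
      RStep (.or (glue xs (.single (.or ys)))) (.or (glue xs ys))
  | r4 (xs : List (SandTree B)) (ys : SandTreeList B) :
      RStep (.and (glue xs (.single (.and ys)))) (.and (glue xs ys))
  | r4' (xs : List (SandTree B)) (ys : SandTreeList B) (zs : List (SandTree B)) :
      RStep (.sand (glue xs (snoc (.single (.sand ys)) zs))) (.sand (glue xs (snoc ys zs)))
  | r5 (t : SandTree B) : RStep (.or (.single t)) t
  | r6 (t : SandTree B) : RStep (.and (.single t)) t
  | r6' (t : SandTree B) : RStep (.sand (.single t)) t
  | r10 (xs : List (SandTree B)) (ys : SandTreeList B) :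
      RStep (.and (glue xs (.single (.or ys))))
        (.or (SandTreeList.map (fun y => .and (glue xs (.single y))) ys))
  | r10' (xs : List (SandTree B)) (ys : SandTreeList B) (zs : List (SandTree B)) :
      RStep (.sand (glue xs (snoc (.single (.or ys)) zs)))
        (.or (SandTreeList.map (fun y => .sand (glue xs (snoc (.single y) zs))) ys))
  | r11 (a : SandTree B) (xs : List (SandTree B)) :
      RStep (.or (.cons a (ofList a xs))) (.or (ofList a xs))

end

/-! Rule application in an arbitrary context. -/
mutual
inductive Rw {B : Type} : SandTree B → SandTree B → Prop
  | root {t t' : SandTree B} : RStep t t' → Rw t t'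
  | or {ts ts' : SandTreeList B} : RwL ts ts' → Rw (.or ts) (.or ts')
  | and {ts ts' : SandTreeList B} : RwL ts ts' → Rw (.and ts) (.and ts')
  | sand {ts ts' : SandTreeList B} : RwL ts ts' → Rw (.sand ts) (.sand ts')
inductive RwL {B : Type} : SandTreeList B → SandTreeList B → Prop
  | single {t t' : SandTree B} : Rw t t' → RwL (.single t) (.single t')
  | head {t t' : SandTree B} {ts : SandTreeList B} : Rw t t' → RwL (.cons t ts) (.cons t' ts)
  | tail {t : SandTree B} {ts ts' : SandTreeList B} : RwL ts ts' → RwL (.cons t ts) (.cons t ts')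
end

/-- One rewrite step of the TRS `⇒`, working modulo commutativity of `OR` and `AND`. -/
def RwMod {B : Type} (t t' : SandTree B) : Prop :=
  ∃ u u' : SandTree B, PEq t u ∧ Rw u u' ∧ PEq u' t'

/-- Zero or more rewrite steps (modulo commutativity of `OR` and `AND`). -/
def RwStar {B : Type} : SandTree B → SandTree B → Prop :=
  Relation.ReflTransGen (fun a b => PEq a b ∨ Rw a b)

/-- A normal form: no rewrite rule is applicable, modulo commutativity of `OR` and `AND`. -/
def NormalForm {B : Type} (t : SandTree B) : Prop :=
  ∀ u t' : SandTree B, PEq t u → ¬ Rw u t'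

/-! The norm `‖·‖`: `‖b‖ = 1`, `‖OR(t₁,…,t_k)‖ = ‖t₁‖+…+‖t_k‖+2`,
`‖AND(t₁,…,t_k)‖ = ‖SAND(t₁,…,t_k)‖ = 2·‖t₁‖·…·‖t_k‖`. -/
mutual
def weight {B : Type} : SandTree B → ℕ
  | .atom _ => 1
  | .or ts => weightSum ts + 2
  | .and ts => 2 * weightProd ts
  | .sand ts => 2 * weightProd ts
def weightSum {B : Type} : SandTreeList B → ℕ
  | .single t => weight t
  | .cons t ts => weight t + weightSum ts
def weightProd {B : Type} : SandTreeList B → ℕ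
  | .single t => weight t
  | .cons t ts => weight t * weightProd ts
end
/-!
Standard attack trees are SAND attack trees containing no `SAND` operator.
The multiset semantics maps a standard attack tree to a set of finite multisets
over `B`: `⟦b⟧_M = {⟨b⟩}`, `⟦OR⟧_M = ⋃ᵢ ⟦tᵢ⟧_M`,
`⟦AND⟧_M = {M₁ ⊎ … ⊎ M_k | Mᵢ ∈ ⟦tᵢ⟧_M}`.
(Its value on trees containing `SAND` is irrelevant and set to `∅`.)
-/

mutual
inductive NoSand {B : Type} : SandTree B → Prop
  | atom (b : B) : NoSand (.atom b)
  | or {ts : SandTreeList B} : NoSandL ts → NoSand (.or ts)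
  | and {ts : SandTreeList B} : NoSandL ts → NoSand (.and ts)
inductive NoSandL {B : Type} : SandTreeList B → Prop
  | single {t : SandTree B} : NoSand t → NoSandL (.single t)
  | cons {t : SandTree B} {ts : SandTreeList B} : NoSand t → NoSandL ts → NoSandL (.cons t ts)
end

mutual
def msem {B : Type} : SandTree B → Set (Multiset B)
  | .atom b => {({b} : Multiset B)}
  | .or ts => msemOr ts
  | .and ts => msemAnd ts
  | .sand _ => ∅
def msemOr {B : Type} : SandTreeList B → Set (Multiset B)
  | .single t => msem t
  | .cons t ts => msem t ∪ msemOr ts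
def msemAnd {B : Type} : SandTreeList B → Set (Multiset B)
  | .single t => msem t
  | .cons t ts => {M | ∃ M1 ∈ msem t, ∃ M2 ∈ msemAnd ts, M = M1 + M2}
end

/-- Parallel composition of a nonempty list of graphs `G ∥ H₁ ∥ … ∥ H_k`. -/
def parAll {B : Type} : SSG B → List (SSG B) → SSG B
  | G, [] => G
  | G, H :: Hs => parAll (G.par H) Hs

/-- SAND attack trees modulo equivalence with respect to the SP semantics
(`t ~ t'` iff `⟦t⟧ = ⟦t'⟧`). -/
def semSetoid (B : Type) : Setoid (SandTree B) :=
  ⟨fun t t' => sem t = sem t', fun _ => rfl, Eq.symm, Eq.trans⟩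

/-- The map induced by the SP semantics on equivalence classes of SAND attack trees. -/
def semClass {B : Type} : Quotient (semSetoid B) → Set (SSG B) :=
  Quotient.lift sem (fun _ _ h => h)

/-!
Bottom-up evaluation of the minimal attack time attribute on SAND attack trees:
`α(b) = β(b)`, `α(OR) = min`, `α(AND) = max`, `α(SAND) = Σ`.
-/

mutual
def attr {B : Type} (β : B → NNReal) : SandTree B → NNReal
  | .atom b => β b
  | .or ts => attrOr β ts
  | .and ts => attrAnd β ts
  | .sand ts => attrSand β ts
def attrOr {B : Type} (β : B → NNReal) : SandTreeList B → NNReal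
  | .single t => attr β t
  | .cons t ts => min (attr β t) (attrOr β ts)
def attrAnd {B : Type} (β : B → NNReal) : SandTreeList B → NNReal
  | .single t => attr β t
  | .cons t ts => max (attr β t) (attrAnd β ts)
def attrSand {B : Type} (β : B → NNReal) : SandTreeList B → NNReal
  | .single t => attr β t
  | .cons t ts => attr β t + attrSand β ts
end
/-!
Standard attack trees as a standalone signature (`B ∪ {OR, AND}`, unranked
operators with `k ≥ 1` arguments), their multiset semantics, and syntactic
consequence from the axiom system `E_SM`.
-/

mutual
inductive ATree (B : Type) : Type
  | atom : B → ATree B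
  | or : ATreeList B → ATree B
  | and : ATreeList B → ATree B
inductive ATreeList (B : Type) : Type
  | single : ATree B → ATreeList B
  | cons : ATree B → ATreeList B → ATreeList B
end

namespace ATreeList

variable {B : Type}

def toList : ATreeList B → List (ATree B)
  | .single t => [t]
  | .cons t ts => t :: ts.toList

def glue : List (ATree B) → ATreeList B → ATreeList B
  | [], ys => ys
  | x :: xs, ys => .cons x (glue xs ys)

def ofList : ATree B → List (ATree B) → ATreeList B
  | t, [] => .single t
  | t, u :: us => .cons t (ofList u us)

def map (f : ATree B → ATree B) : ATreeList B → ATreeList B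
  | .single t => .single (f t)
  | .cons t ts => .cons (f t) (map f ts)

end ATreeList

/-! The multiset semantics of standard attack trees. -/

mutual
def amsem {B : Type} : ATree B → Set (Multiset B)
  | .atom b => {({b} : Multiset B)}
  | .or ts => amsemOr ts
  | .and ts => amsemAnd ts
def amsemOr {B : Type} : ATreeList B → Set (Multiset B)
  | .single t => amsem t
  | .cons t ts => amsem t ∪ amsemOr ts
def amsemAnd {B : Type} : ATreeList B → Set (Multiset B)
  | .single t => amsem t
  | .cons t ts => {M | ∃ M1 ∈ amsem t, ∃ M2 ∈ amsemAnd ts, M = M1 + M2}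
end

/-!
Syntactic consequence from `E_SM = {E1, E2, E3, E4, E5, E6, E10, E11}`.
Axiom schemes are represented by all of their instances (closure under
substitution is then automatic), and closure under replacement in contexts is
represented by the congruence rules.
-/

section
open ATreeList
mutual
inductive DerivASM {B : Type} : ATree B → ATree B → Prop
  | refl (t : ATree B) : DerivASM t t
  | symm {t u : ATree B} : DerivASM t u → DerivASM u t
  | trans {t u v : ATree B} : DerivASM t u → DerivASM u v → DerivASM t v
  | congrOr {ts ts' : ATreeList B} : DerivASML ts ts' → DerivASM (.or ts) (.or ts')
  | congrAnd {ts ts' : ATreeList B} : DerivASML ts ts' → DerivASM (.and ts) (.and ts')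
  /- (E1) -/
  | ax1 {ts ts' : ATreeList B} : ts.toList.Perm ts'.toList → DerivASM (.or ts) (.or ts')
  /- (E2) -/
  | ax2 {ts ts' : ATreeList B} : ts.toList.Perm ts'.toList → DerivASM (.and ts) (.and ts')
  /- (E3) -/
  | ax3 (xs : List (ATree B)) (ys : ATreeList B) :
      DerivASM (.or (glue xs (.single (.or ys)))) (.or (glue xs ys))
  /- (E4) -/
  | ax4 (xs : List (ATree B)) (ys : ATreeList B) :
      DerivASM (.and (glue xs (.single (.and ys)))) (.and (glue xs ys))
  /- (E5) -/
  | ax5 (t : ATree B) : DerivASM (.or (.single t)) t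
  /- (E6) -/
  | ax6 (t : ATree B) : DerivASM (.and (.single t)) t
  /- (E10) -/
  | ax10 (xs : List (ATree B)) (ys : ATreeList B) :
      DerivASM (.and (glue xs (.single (.or ys))))
        (.or (ATreeList.map (fun y => .and (glue xs (.single y))) ys))
  /- (E11) -/
  | ax11 (a : ATree B) (xs : List (ATree B)) :
      DerivASM (.or (.cons a (ofList a xs))) (.or (ofList a xs))
inductive DerivASML {B : Type} : ATreeList B → ATreeList B → Prop
  | single {t t' : ATree B} : DerivASM t t' → DerivASML (.single t) (.single t')
  | cons {t t' : ATree B} {ts ts' : ATreeList B} :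
      DerivASM t t' → DerivASML ts ts' → DerivASML (.cons t ts) (.cons t' ts')
end
end
/-! ### Isomorphisms of source-sink graphs -/

namespace SSG

variable {B : Type}

/-- Relabelling of the end points of a labeled edge. -/
def mapEdge {V W : Type} (f : V → W) (e : V × B × V) : W × B × W := (f e.1, e.2.1, f e.2.2)

/-- Relabelling of the end points of a multiset of labeled edges. -/
def mapEdges {V W : Type} (f : V → W) (E : Multiset (V × B × V)) : Multiset (W × B × W) :=
  E.map (mapEdge f)

theorem mapEdges_add {V W : Type} (f : V → W) (E E' : Multiset (V × B × V)) :
    mapEdges f (E + E') = mapEdges f E + mapEdges f E' :=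
  Multiset.map_add _ _ _

theorem mapEdges_mapEdges {V W X : Type} (g : W → X) (f : V → W) (E : Multiset (V × B × V)) :
    mapEdges g (mapEdges f E) = mapEdges (g ∘ f) E :=
  Multiset.map_map _ _ _

/-- The inclusion of the first graph into the sequential composition. -/
def seqInl (G H : SSG B) : G.V → (G.seq H).V := G.seqEmbed H

/-- The inclusion of the second graph into the sequential composition. -/
def seqInr (G G' : SSG B) : G'.V → (G.seq G').V := Sum.inr

/-- The inclusion of the first graph into the parallel composition. -/
def parInl (G H : SSG B) : G.V → (G.par H).V := G.parEmbed H

/-- The inclusion of the second graph into the parallel composition. -/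
def parInr (G G' : SSG B) : G'.V → (G.par G').V := Sum.inr

theorem seq_edges (G G' : SSG B) :
    (G.seq G').E = mapEdges (seqInl G G') G.E + mapEdges (seqInr G G') G'.E := rfl

theorem par_edges (G G' : SSG B) :
    (G.par G').E = mapEdges (parInl G G') G.E + mapEdges (parInr G G') G'.E := rfl

theorem Iso.refl (G : SSG B) : G.Iso G := ⟨Equiv.refl _, by simp, rfl, rfl⟩

theorem Iso.symm {G H : SSG B} (h : G.Iso H) : H.Iso G := by
  obtain ⟨f, hE, hs, hz⟩ := h
  refine ⟨f.symm, ?_, by simp [← hs], by simp [← hz]⟩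
  simp [← hE, Multiset.map_map]

theorem Iso.trans {G H K : SSG B} (h : G.Iso H) (h' : H.Iso K) : G.Iso K := by
  obtain ⟨f, hE, hs, hz⟩ := h
  obtain ⟨g, hE', hs', hz'⟩ := h'
  refine ⟨f.trans g, ?_, by simp [hs, hs'], by simp [hz, hz']⟩
  simp [← hE', ← hE, Multiset.map_map]

theorem seqEmbed_sink (G G' : SSG B) : G.seqEmbed G' G.z = Sum.inr G'.s := by
  simp [seqEmbed]

theorem seqEmbed_of_ne (G G' : SSG B) {v : G.V} (h : v ≠ G.z) :
    G.seqEmbed G' v = Sum.inl ⟨v, h⟩ := by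
  simp [seqEmbed, h]

theorem parEmbed_source (G G' : SSG B) : G.parEmbed G' G.s = Sum.inr G'.s := by
  simp [parEmbed]

theorem parEmbed_sink (G G' : SSG B) : G.parEmbed G' G.z = Sum.inr G'.z := by
  simp [parEmbed, G.ne.symm]

theorem parEmbed_of_ne (G G' : SSG B) {v : G.V} (hs : v ≠ G.s) (hz : v ≠ G.z) :
    G.parEmbed G' v = Sum.inl ⟨v, hs, hz⟩ := by
  simp [parEmbed, hs, hz]

/-- Recognition of a graph as a sequential composition. -/
theorem seq_iso_of_maps {G G' H : SSG B} (i : G.V → H.V) (j : G'.V → H.V)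
    (hi : i.Injective) (hj : j.Injective) (hij : i G.z = j G'.s)
    (hdisj : ∀ u v, i u = j v → u = G.z)
    (hsurj : ∀ w, (∃ u, i u = w) ∨ ∃ v, j v = w)
    (hE : H.E = mapEdges i G.E + mapEdges j G'.E)
    (hs : i G.s = H.s) (hz : j G'.z = H.z) : (G.seq G').Iso H := by
  let f : (G.seq G').V → H.V := Sum.elim (fun u => i u.1) j
  have hf : ∀ v, f (G.seqEmbed G' v) = i v := by
    intro v
    by_cases h : v = G.z
    · subst h; rw [seqEmbed_sink]; exact hij.symm
    · rw [seqEmbed_of_ne _ _ h]; rfl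
  have hbij : f.Bijective := by
    constructor
    · rintro (⟨u, hu⟩ | v) (⟨u', hu'⟩ | v') h
      · have : u = u' := hi h
        subst this; rfl
      · exact absurd (hdisj _ _ h) hu
      · exact absurd (hdisj _ _ h.symm) hu'
      · exact congrArg Sum.inr (hj h)
    · intro w
      rcases hsurj w with ⟨u, rfl⟩ | ⟨v, rfl⟩
      · exact ⟨G.seqEmbed G' u, hf u⟩
      · exact ⟨Sum.inr v, rfl⟩
  refine ⟨Equiv.ofBijective f hbij, ?_, hs, hz⟩
  change mapEdges f (G.seq G').E = H.E
  rw [hE, seq_edges, mapEdges_add, mapEdges_mapEdges, mapEdges_mapEdges]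
  exact congrArg (fun k => mapEdges k G.E + _) (funext hf)

/-- Recognition of a graph as a parallel composition. -/
theorem par_iso_of_maps {G G' H : SSG B} (i : G.V → H.V) (j : G'.V → H.V)
    (hi : i.Injective) (hj : j.Injective) (hijs : i G.s = j G'.s) (hijz : i G.z = j G'.z)
    (hdisj : ∀ u v, i u = j v → u = G.s ∨ u = G.z)
    (hsurj : ∀ w, (∃ u, i u = w) ∨ ∃ v, j v = w)
    (hE : H.E = mapEdges i G.E + mapEdges j G'.E)
    (hs : j G'.s = H.s) (hz : j G'.z = H.z) : (G.par G').Iso H := by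
  let f : (G.par G').V → H.V := Sum.elim (fun u => i u.1) j
  have hf : ∀ v, f (G.parEmbed G' v) = i v := by
    intro v
    by_cases h : v = G.s
    · subst h; rw [parEmbed_source]; exact hijs.symm
    by_cases h' : v = G.z
    · subst h'; rw [parEmbed_sink]; exact hijz.symm
    · rw [parEmbed_of_ne _ _ h h']; rfl
  have hbij : f.Bijective := by
    constructor
    · rintro (⟨u, hu⟩ | v) (⟨u', hu'⟩ | v') h
      · have : u = u' := hi h
        subst this; rfl
      · exact absurd (hdisj _ _ h) (not_or.2 hu)
      · exact absurd (hdisj _ _ h.symm) (not_or.2 hu')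
      · exact congrArg Sum.inr (hj h)
    · intro w
      rcases hsurj w with ⟨u, rfl⟩ | ⟨v, rfl⟩
      · exact ⟨G.parEmbed G' u, hf u⟩
      · exact ⟨Sum.inr v, rfl⟩
  refine ⟨Equiv.ofBijective f hbij, ?_, hs, hz⟩
  change mapEdges f (G.par G').E = H.E
  rw [hE, par_edges, mapEdges_add, mapEdges_mapEdges, mapEdges_mapEdges]
  exact congrArg (fun k => mapEdges k G.E + _) (funext hf)

theorem seqEmbed_eq_inr (G G' : SSG B) {u : G.V} {v : G'.V}
    (h : G.seqEmbed G' u = Sum.inr v) : u = G.z ∧ v = G'.s := by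
  by_cases hu : u = G.z
  · subst hu; rw [seqEmbed_sink] at h; exact ⟨rfl, (Sum.inr_injective h).symm⟩
  · rw [seqEmbed_of_ne _ _ hu] at h; cases h

theorem seqEmbed_injective (G G' : SSG B) : (G.seqEmbed G').Injective := by
  intro u v h
  by_cases hv : v = G.z
  · subst hv; rw [seqEmbed_sink] at h; exact (seqEmbed_eq_inr _ _ h).1
  · by_cases hu : u = G.z
    · subst hu; rw [seqEmbed_sink] at h; exact (seqEmbed_eq_inr _ _ h.symm).1.symm
    · rw [seqEmbed_of_ne _ _ hv, seqEmbed_of_ne _ _ hu] at h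
      exact congrArg Subtype.val (Sum.inl_injective h)

theorem parEmbed_eq_inr (G G' : SSG B) {u : G.V} {v : G'.V}
    (h : G.parEmbed G' u = Sum.inr v) : (u = G.s ∧ v = G'.s) ∨ (u = G.z ∧ v = G'.z) := by
  by_cases hs : u = G.s
  · subst hs; rw [parEmbed_source] at h; exact Or.inl ⟨rfl, (Sum.inr_injective h).symm⟩
  by_cases hz : u = G.z
  · subst hz; rw [parEmbed_sink] at h; exact Or.inr ⟨rfl, (Sum.inr_injective h).symm⟩
  · rw [parEmbed_of_ne _ _ hs hz] at h; cases h

theorem parEmbed_eq_inl (G G' : SSG B) {u : G.V} {v : {u : G.V // u ≠ G.s ∧ u ≠ G.z}}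
    (h : G.parEmbed G' u = Sum.inl v) : u = v.1 := by
  by_cases hs : u = G.s
  · subst hs; rw [parEmbed_source] at h; cases h
  by_cases hz : u = G.z
  · subst hz; rw [parEmbed_sink] at h; cases h
  · rw [parEmbed_of_ne _ _ hs hz] at h; exact congrArg Subtype.val (Sum.inl_injective h)

theorem parEmbed_injective (G G' : SSG B) : (G.parEmbed G').Injective := by
  intro u v h
  rcases hw : G.parEmbed G' v with w | w
  · rw [parEmbed_eq_inl _ _ hw, parEmbed_eq_inl _ _ (h.trans hw)]
  · have hne := G'.ne
    rcases parEmbed_eq_inr _ _ hw with ⟨h1, h2⟩ | ⟨h1, h2⟩ <;>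
      rcases parEmbed_eq_inr _ _ (h.trans hw) with ⟨h3, h4⟩ | ⟨h3, h4⟩ <;> simp_all

theorem seq_vertex_cases (G G' : SSG B) (w : (G.seq G').V) :
    (∃ u, G.seqEmbed G' u = w) ∨ ∃ v, Sum.inr v = w := by
  rcases w with ⟨u, hu⟩ | v
  · exact Or.inl ⟨u, seqEmbed_of_ne _ _ hu⟩
  · exact Or.inr ⟨v, rfl⟩

theorem par_vertex_cases (G G' : SSG B) (w : (G.par G').V) :
    (∃ u, G.parEmbed G' u = w) ∨ ∃ v, Sum.inr v = w := by
  rcases w with ⟨u, hu, hu'⟩ | v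
  · exact Or.inl ⟨u, parEmbed_of_ne _ _ hu hu'⟩
  · exact Or.inr ⟨v, rfl⟩

theorem Iso.seq {G G' H H' : SSG B} (h : G.Iso H) (h' : G'.Iso H') :
    (G.seq G').Iso (H.seq H') := by
  obtain ⟨f, hE, hs, hz⟩ := h
  obtain ⟨g, hE', hs', hz'⟩ := h'
  refine seq_iso_of_maps (fun u => H.seqEmbed H' (f u)) (fun v => Sum.inr (g v))
    ((seqEmbed_injective H H').comp f.injective) (Sum.inr_injective.comp g.injective)
    ?_ ?_ ?_ ?_ ?_ ?_
  · rw [hz, hs', seqEmbed_sink]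
  · intro u v h
    exact f.injective ((seqEmbed_eq_inr _ _ h).1.trans hz.symm)
  · intro w
    rcases seq_vertex_cases H H' w with ⟨u, rfl⟩ | ⟨v, rfl⟩
    · exact Or.inl ⟨f.symm u, by rw [Equiv.apply_symm_apply]⟩
    · exact Or.inr ⟨g.symm v, by rw [Equiv.apply_symm_apply]⟩
  · rw [seq_edges, ← hE, ← hE']
    exact congrArg₂ (· + ·) (mapEdges_mapEdges _ _ _) (mapEdges_mapEdges _ _ _)
  · rw [hs, seqEmbed_of_ne _ _ H.ne]; rfl
  · rw [hz']; rfl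

theorem Iso.par {G G' H H' : SSG B} (h : G.Iso H) (h' : G'.Iso H') :
    (G.par G').Iso (H.par H') := by
  obtain ⟨f, hE, hs, hz⟩ := h
  obtain ⟨g, hE', hs', hz'⟩ := h'
  refine par_iso_of_maps (fun u => H.parEmbed H' (f u)) (fun v => Sum.inr (g v))
    ((parEmbed_injective H H').comp f.injective) (Sum.inr_injective.comp g.injective)
    ?_ ?_ ?_ ?_ ?_ ?_ ?_
  · rw [hs, hs', parEmbed_source]
  · rw [hz, hz', parEmbed_sink]
  · intro u v h
    rcases parEmbed_eq_inr _ _ h with h | h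
    · exact Or.inl (f.injective (h.1.trans hs.symm))
    · exact Or.inr (f.injective (h.1.trans hz.symm))
  · intro w
    rcases par_vertex_cases H H' w with ⟨u, rfl⟩ | ⟨v, rfl⟩
    · exact Or.inl ⟨f.symm u, by rw [Equiv.apply_symm_apply]⟩
    · exact Or.inr ⟨g.symm v, by rw [Equiv.apply_symm_apply]⟩
  · rw [par_edges, ← hE, ← hE']
    exact congrArg₂ (· + ·) (mapEdges_mapEdges _ _ _) (mapEdges_mapEdges _ _ _)
  · rw [hs']; rfl
  · rw [hz']; rfl

theorem seq_assoc_iso (G G' G'' : SSG B) :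
    ((G.seq G').seq G'').Iso (G.seq (G'.seq G'')) := by
  let i : (G.seq G').V → (G.seq (G'.seq G'')).V :=
    Sum.elim (fun u => Sum.inl u) (fun v => Sum.inr (G'.seqEmbed G'' v))
  have hi : ∀ u, i (G.seqEmbed G' u) = G.seqEmbed (G'.seq G'') u := by
    intro u
    by_cases hu : u = G.z
    · subst hu
      rw [seqEmbed_sink, seqEmbed_sink]
      exact congrArg Sum.inr (seqEmbed_of_ne _ _ G'.ne)
    · rw [seqEmbed_of_ne _ _ hu, seqEmbed_of_ne _ _ hu]; rfl
  refine seq_iso_of_maps i (fun v => Sum.inr (Sum.inr v)) ?_ ?_ ?_ ?_ ?_ ?_ rfl rfl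
  · rintro (u | v) (u' | v') h
    · exact congrArg Sum.inl (Sum.inl_injective h)
    · cases h
    · cases h
    · exact congrArg Sum.inr (seqEmbed_injective _ _ (Sum.inr_injective h))
  · exact Sum.inr_injective.comp Sum.inr_injective
  · exact congrArg Sum.inr (seqEmbed_sink _ _)
  · rintro (u | v) w h
    · cases h
    · exact congrArg Sum.inr (seqEmbed_eq_inr _ _ (Sum.inr_injective h)).1
  · rintro (u | w)
    · exact Or.inl ⟨Sum.inl u, rfl⟩
    · rcases seq_vertex_cases G' G'' w with ⟨u, rfl⟩ | ⟨v, rfl⟩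
      · exact Or.inl ⟨Sum.inr u, rfl⟩
      · exact Or.inr ⟨v, rfl⟩
  · rw [seq_edges, seq_edges, seq_edges, mapEdges_add, mapEdges_add, mapEdges_mapEdges,
      mapEdges_mapEdges, mapEdges_mapEdges, mapEdges_mapEdges, ← add_assoc]
    exact congrArg (fun k => mapEdges k G.E + _ + _) (funext fun u => (hi u).symm)

theorem par_assoc_iso (G G' G'' : SSG B) :
    ((G.par G').par G'').Iso (G.par (G'.par G'')) := by
  let i : (G.par G').V → (G.par (G'.par G'')).V :=
    Sum.elim (fun u => Sum.inl u) (fun v => Sum.inr (G'.parEmbed G'' v))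
  have hi : ∀ u, i (G.parEmbed G' u) = G.parEmbed (G'.par G'') u := by
    intro u
    by_cases hu : u = G.s
    · subst hu
      rw [parEmbed_source, parEmbed_source]
      exact congrArg Sum.inr (parEmbed_source _ _)
    by_cases hu' : u = G.z
    · subst hu'
      rw [parEmbed_sink, parEmbed_sink]
      exact congrArg Sum.inr (parEmbed_sink _ _)
    · rw [parEmbed_of_ne _ _ hu hu', parEmbed_of_ne _ _ hu hu']; rfl
  refine par_iso_of_maps i (fun v => Sum.inr (Sum.inr v)) ?_ ?_ ?_ ?_ ?_ ?_ ?_ rfl rfl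
  · rintro (u | v) (u' | v') h
    · exact congrArg Sum.inl (Sum.inl_injective h)
    · cases h
    · cases h
    · exact congrArg Sum.inr (parEmbed_injective _ _ (Sum.inr_injective h))
  · exact Sum.inr_injective.comp Sum.inr_injective
  · exact congrArg Sum.inr (parEmbed_source _ _)
  · exact congrArg Sum.inr (parEmbed_sink _ _)
  · rintro (u | v) w h
    · cases h
    · rcases parEmbed_eq_inr _ _ (Sum.inr_injective h) with h | h
      · exact Or.inl (congrArg Sum.inr h.1)
      · exact Or.inr (congrArg Sum.inr h.1)
  · rintro (u | w)
    · exact Or.inl ⟨Sum.inl u, rfl⟩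
    · rcases par_vertex_cases G' G'' w with ⟨u, rfl⟩ | ⟨v, rfl⟩
      · exact Or.inl ⟨Sum.inr u, rfl⟩
      · exact Or.inr ⟨v, rfl⟩
  · rw [par_edges, par_edges, par_edges, mapEdges_add, mapEdges_add, mapEdges_mapEdges,
      mapEdges_mapEdges, mapEdges_mapEdges, mapEdges_mapEdges, ← add_assoc]
    exact congrArg (fun k => mapEdges k G.E + _ + _) (funext fun u => (hi u).symm)

theorem par_comm_iso (G G' : SSG B) : (G.par G').Iso (G'.par G) := by
  refine par_iso_of_maps (fun u => Sum.inr u) (G'.parEmbed G) Sum.inr_injective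
    (parEmbed_injective _ _) (parEmbed_source _ _).symm (parEmbed_sink _ _).symm ?_ ?_ ?_
    (parEmbed_source _ _) (parEmbed_sink _ _)
  · intro u v h
    exact (parEmbed_eq_inr _ _ h.symm).imp And.right And.right
  · exact fun w => (par_vertex_cases G' G w).symm
  · exact add_comm _ _

end SSG

/-! ### Series-parallel terms and series-parallel orders -/

/-- Terms built from basic actions by binary sequential and parallel composition. -/
inductive SPTerm (B : Type) : Type
  | atom : B → SPTerm B
  | seq : SPTerm B → SPTerm B → SPTerm B
  | par : SPTerm B → SPTerm B → SPTerm B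

namespace SPTerm

variable {B : Type}

/-- The congruence generated by associativity of both operations and commutativity of the
parallel composition. -/
inductive Equiv : SPTerm B → SPTerm B → Prop
  | refl (s : SPTerm B) : Equiv s s
  | symm {s t : SPTerm B} : Equiv s t → Equiv t s
  | trans {s t u : SPTerm B} : Equiv s t → Equiv t u → Equiv s u
  | seqCongr {s s' t t' : SPTerm B} : Equiv s s' → Equiv t t' → Equiv (s.seq t) (s'.seq t')
  | parCongr {s s' t t' : SPTerm B} : Equiv s s' → Equiv t t' → Equiv (s.par t) (s'.par t')
  | seqAssoc (s t u : SPTerm B) : Equiv ((s.seq t).seq u) (s.seq (t.seq u))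
  | parAssoc (s t u : SPTerm B) : Equiv ((s.par t).par u) (s.par (t.par u))
  | parComm (s t : SPTerm B) : Equiv (s.par t) (t.par s)

/-- Equivalence of terms as a setoid. -/
instance setoid (B : Type) : Setoid (SPTerm B) :=
  ⟨Equiv, Equiv.refl, Equiv.symm, Equiv.trans⟩

/-- Series-parallel terms up to equivalence. -/
abbrev Class (B : Type) : Type := Quotient (setoid B)

/-- Sequential composition of classes of terms. -/
instance : Semigroup (Class B) where
  mul := Quotient.map₂ SPTerm.seq fun _ _ h _ _ h' => Equiv.seqCongr h h'
  mul_assoc := by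
    rintro ⟨s⟩ ⟨t⟩ ⟨u⟩
    exact Quotient.sound (Equiv.seqAssoc s t u)

/-- Parallel composition of classes of terms. -/
instance : AddCommSemigroup (Class B) where
  add := Quotient.map₂ SPTerm.par fun _ _ h _ _ h' => Equiv.parCongr h h'
  add_assoc := by
    rintro ⟨s⟩ ⟨t⟩ ⟨u⟩
    exact Quotient.sound (Equiv.parAssoc s t u)
  add_comm := by
    rintro ⟨s⟩ ⟨t⟩
    exact Quotient.sound (Equiv.parComm s t)

theorem mk_seq (s t : SPTerm B) : (⟦s.seq t⟧ : Class B) = ⟦s⟧ * ⟦t⟧ := rfl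

theorem mk_par (s t : SPTerm B) : (⟦s.par t⟧ : Class B) = ⟦s⟧ + ⟦t⟧ := rfl

theorem equiv_of_mk_eq {s t : SPTerm B} (h : (⟦s⟧ : Class B) = ⟦t⟧) : Equiv s t :=
  Quotient.exact h

theorem mk_eq_of_equiv {s t : SPTerm B} (h : Equiv s t) : (⟦s⟧ : Class B) = ⟦t⟧ :=
  Quotient.sound h

/-- `Rep lt lab s M`: the multiset `M`, with the relation `lt` and the labelling `lab`, is the
series-parallel labelled order described by `s`. -/
inductive Rep {α : Type} (lt : α → α → Prop) (lab : α → B) : SPTerm B → Multiset α → Prop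
  | atom (a : α) : Rep lt lab (.atom (lab a)) {a}
  | seq {s t : SPTerm B} {M N : Multiset α} : Rep lt lab s M → Rep lt lab t N →
      (∀ x ∈ M, ∀ y ∈ N, lt x y) → Rep lt lab (s.seq t) (M + N)
  | par {s t : SPTerm B} {M N : Multiset α} : Rep lt lab s M → Rep lt lab t N →
      (∀ x ∈ M, ∀ y ∈ N, ¬ lt x y ∧ ¬ lt y x) → Rep lt lab (s.par t) (M + N)

theorem Rep.ne_zero {α : Type} {lt : α → α → Prop} {lab : α → B} {s : SPTerm B}
    {M : Multiset α} (h : Rep lt lab s M) : M ≠ 0 := by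
  induction h with
  | atom a => simp
  | seq _ _ _ ih _ => simp [ih]
  | par _ _ _ ih _ => simp [ih]

theorem Rep.map {α β : Type} {lt : α → α → Prop} {lab : α → B} {lt' : β → β → Prop}
    {lab' : β → B} (f : α → β) {s : SPTerm B} {M : Multiset α} (h : Rep lt lab s M)
    (hlab : ∀ x, lab' (f x) = lab x) (hlt : ∀ x ∈ M, ∀ y ∈ M, (lt' (f x) (f y) ↔ lt x y)) :
    Rep lt' lab' s (M.map f) := by
  induction h with
  | atom a => rw [← hlab a, Multiset.map_singleton]; exact Rep.atom _
  | @seq s t M N _ _ hMN ih ih' =>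
    rw [Multiset.map_add]
    refine Rep.seq (ih fun x hx y hy => hlt x (by simp [hx]) y (by simp [hy]))
      (ih' fun x hx y hy => hlt x (by simp [hx]) y (by simp [hy])) ?_
    simp only [Multiset.mem_map, forall_exists_index, and_imp]
    rintro _ x hx rfl _ y hy rfl
    exact (hlt x (by simp [hx]) y (by simp [hy])).2 (hMN x hx y hy)
  | @par s t M N _ _ hMN ih ih' =>
    rw [Multiset.map_add]
    refine Rep.par (ih fun x hx y hy => hlt x (by simp [hx]) y (by simp [hy]))
      (ih' fun x hx y hy => hlt x (by simp [hx]) y (by simp [hy])) ?_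
    simp only [Multiset.mem_map, forall_exists_index, and_imp]
    rintro _ x hx rfl _ y hy rfl
    rw [hlt x (by simp [hx]) y (by simp [hy]), hlt y (by simp [hy]) x (by simp [hx])]
    exact hMN x hx y hy

/-- Common refinement of two decompositions of a multiset. -/
theorem exists_refinement {α : Type} {A C D E : Multiset α} (h : A + C = D + E) :
    ∃ P Q R S, A = P + Q ∧ C = R + S ∧ D = P + R ∧ E = Q + S := by
  classical
  refine ⟨A ∩ D, A - D, D - A, C - (D - A), ?_, ?_, ?_, ?_⟩ <;>
  · ext a
    have := congrArg (Multiset.count a) h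
    simp only [Multiset.count_add, Multiset.count_inter, Multiset.count_sub] at *
    omega

theorem eq_zero_or_eq_zero {α : Type} {M N : Multiset α} (h : ∀ x ∈ M, ∀ y ∈ N, False) :
    M = 0 ∨ N = 0 := by
  by_contra! hne
  obtain ⟨x, hx⟩ := Multiset.exists_mem_of_ne_zero hne.1
  obtain ⟨y, hy⟩ := Multiset.exists_mem_of_ne_zero hne.2
  exact h x hx y hy

theorem singleton_eq_add {α : Type} {a : α} {M N : Multiset α} (h : {a} = M + N) :
    M = 0 ∨ N = 0 := by
  have := congrArg Multiset.card h
  simp only [Multiset.card_singleton, Multiset.card_add] at this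
  rw [← Multiset.card_eq_zero, ← Multiset.card_eq_zero]
  omega

/-- A nonempty set cannot be split in two nonempty parts both in series and in parallel. -/
theorem not_series_and_parallel {α : Type} {lt : α → α → Prop} {A C D E : Multiset α}
    (h : A + C = D + E) (hA : A ≠ 0) (hC : C ≠ 0) (hD : D ≠ 0) (hE : E ≠ 0)
    (hser : ∀ x ∈ A, ∀ y ∈ C, lt x y) (hpar : ∀ x ∈ D, ∀ y ∈ E, ¬ lt x y ∧ ¬ lt y x) :
    False := by
  obtain ⟨P, Q, R, S, rfl, rfl, rfl, rfl⟩ := exists_refinement h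
  have h1 : P = 0 ∨ S = 0 := eq_zero_or_eq_zero fun x hx y hy =>
    (hpar x (by simp [hx]) y (by simp [hy])).1 (hser x (by simp [hx]) y (by simp [hy]))
  have h2 : Q = 0 ∨ R = 0 := eq_zero_or_eq_zero fun x hx y hy =>
    (hpar y (by simp [hy]) x (by simp [hx])).2 (hser x (by simp [hx]) y (by simp [hy]))
  rcases h1 with rfl | rfl <;> rcases h2 with rfl | rfl <;> simp_all

/-- Splitting a representation along a series decomposition. -/
theorem Rep.split_series {α : Type} {lt : α → α → Prop} {lab : α → B} {t : SPTerm B}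
    {M : Multiset α} (h : Rep lt lab t M) (hasymm : ∀ x ∈ M, ∀ y ∈ M, lt x y → ¬ lt y x)
    {A C : Multiset α} (hM : M = A + C) (hA : A ≠ 0) (hC : C ≠ 0)
    (hser : ∀ x ∈ A, ∀ y ∈ C, lt x y) :
    ∃ u v, Rep lt lab u A ∧ Rep lt lab v C ∧ Equiv t (u.seq v) := by
  induction h generalizing A C with
  | atom a => rcases singleton_eq_add hM with h | h <;> contradiction
  | par hs ht hpar =>
    exact (not_series_and_parallel hM.symm hA hC hs.ne_zero ht.ne_zero hser hpar).elim
  | @seq s t M N hs ht hMN ihs iht =>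
    replace ihs := @ihs fun x hx y hy =>
      hasymm x (Multiset.mem_add.2 (.inl hx)) y (Multiset.mem_add.2 (.inl hy))
    replace iht := @iht fun x hx y hy =>
      hasymm x (Multiset.mem_add.2 (.inr hx)) y (Multiset.mem_add.2 (.inr hy))
    obtain ⟨P, Q, R, S, rfl, rfl, rfl, rfl⟩ := exists_refinement hM
    have hQR : Q = 0 ∨ R = 0 := eq_zero_or_eq_zero fun x hx y hy =>
      hasymm x (by simp [hx]) y (by simp [hy]) (hMN x (by simp [hx]) y (by simp [hy]))
        (hser y (by simp [hy]) x (by simp [hx]))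
    clear hasymm hM
    by_cases hQ : Q = 0
    · subst hQ
      rw [add_zero] at hs hMN
      rw [zero_add] at hC hser ⊢
      by_cases hR : R = 0
      · subst hR
        rw [zero_add] at ht
        rw [add_zero]
        exact ⟨s, t, hs, ht, .refl _⟩
      · obtain ⟨u, v, hu, hv, huv⟩ := iht rfl hR hC fun x hx y hy => hser x (by simp [hx]) y hy
        refine ⟨s.seq u, v, .seq hs hu fun x hx y hy => hMN x hx y (by simp [hy]), hv, ?_⟩
        exact (Equiv.seqCongr (.refl s) huv).trans (Equiv.seqAssoc s u v).symm
    · obtain rfl := hQR.resolve_left hQ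
      rw [zero_add] at ht hMN
      rw [add_zero] at hA hser ⊢
      obtain ⟨u, v, hu, hv, huv⟩ := ihs rfl hA hQ fun x hx y hy => hser x hx y (by simp [hy])
      refine ⟨u, v.seq t, hu, .seq hv ht fun x hx y hy => hMN x (by simp [hx]) y hy, ?_⟩
      exact (Equiv.seqCongr huv (.refl t)).trans (Equiv.seqAssoc u v t)

/-- Splitting a representation along a parallel decomposition. -/
theorem Rep.split_parallel {α : Type} {lt : α → α → Prop} {lab : α → B} {t : SPTerm B}
    {M : Multiset α} (h : Rep lt lab t M)
    {A C : Multiset α} (hM : M = A + C) (hA : A ≠ 0) (hC : C ≠ 0)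
    (hpar : ∀ x ∈ A, ∀ y ∈ C, ¬ lt x y ∧ ¬ lt y x) :
    ∃ u v, Rep lt lab u A ∧ Rep lt lab v C ∧ Equiv t (u.par v) := by
  induction h generalizing A C with
  | atom a => rcases singleton_eq_add hM with h | h <;> contradiction
  | seq hs ht hser =>
    exact (not_series_and_parallel hM hs.ne_zero ht.ne_zero hA hC hser hpar).elim
  | @par s t M N hs ht hMN ihs iht =>
    obtain ⟨P, Q, R, S, rfl, rfl, rfl, rfl⟩ := exists_refinement hM
    have hP : (P = 0 ∧ Rep lt lab s Q) ∨ (Q = 0 ∧ Rep lt lab s P) ∨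
        ∃ u v, Rep lt lab u P ∧ Rep lt lab v Q ∧ Equiv s (u.par v) := by
      by_cases hP : P = 0
      · subst hP; exact .inl ⟨rfl, by simpa using hs⟩
      by_cases hQ : Q = 0
      · subst hQ; exact .inr (.inl ⟨rfl, by simpa using hs⟩)
      exact .inr (.inr (ihs rfl hP hQ fun x hx y hy => hpar x (by simp [hx]) y (by simp [hy])))
    have hR : (R = 0 ∧ Rep lt lab t S) ∨ (S = 0 ∧ Rep lt lab t R) ∨
        ∃ u v, Rep lt lab u R ∧ Rep lt lab v S ∧ Equiv t (u.par v) := by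
      by_cases hR : R = 0
      · subst hR; exact .inl ⟨rfl, by simpa using ht⟩
      by_cases hS : S = 0
      · subst hS; exact .inr (.inl ⟨rfl, by simpa using ht⟩)
      exact .inr (.inr (iht rfl hR hS fun x hx y hy => hpar x (by simp [hx]) y (by simp [hy])))
    have hPR : ∀ x ∈ P, ∀ y ∈ R, ¬ lt x y ∧ ¬ lt y x :=
      fun x hx y hy => hMN x (by simp [hx]) y (by simp [hy])
    have hQS : ∀ x ∈ Q, ∀ y ∈ S, ¬ lt x y ∧ ¬ lt y x :=
      fun x hx y hy => hMN x (by simp [hx]) y (by simp [hy])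
    rcases hP with ⟨rfl, hs'⟩ | ⟨rfl, hs'⟩ | ⟨a, b, ha, hb, hab⟩ <;>
      rcases hR with ⟨rfl, ht'⟩ | ⟨rfl, ht'⟩ | ⟨u, v, hu, hv, huv⟩
    · exact (hA (add_zero 0)).elim
    · rw [zero_add, add_zero]
      exact ⟨t, s, ht', hs', .parComm _ _⟩
    · rw [zero_add]
      refine ⟨u, s.par v, hu, .par hs' hv hQS, equiv_of_mk_eq ?_⟩
      rw [mk_par, mk_eq_of_equiv huv, mk_par, mk_par, mk_par, add_left_comm]
    · rw [zero_add, add_zero]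
      exact ⟨s, t, hs', ht', .refl _⟩
    · exact (hC (add_zero 0)).elim
    · rw [zero_add]
      refine ⟨s.par u, v, .par hs' hu hPR, hv, equiv_of_mk_eq ?_⟩
      rw [mk_par, mk_eq_of_equiv huv, mk_par, mk_par, mk_par, add_assoc]
    · rw [add_zero]
      refine ⟨a, b.par t, ha, .par hb ht' hQS, equiv_of_mk_eq ?_⟩
      rw [mk_par, mk_eq_of_equiv hab, mk_par, mk_par, mk_par, add_assoc]
    · rw [add_zero]
      refine ⟨a.par t, b, .par ha ht' hPR, hb, equiv_of_mk_eq ?_⟩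
      rw [mk_par, mk_eq_of_equiv hab, mk_par, mk_par, mk_par, add_right_comm]
    · refine ⟨a.par u, b.par v, .par ha hu hPR, .par hb hv hQS, equiv_of_mk_eq ?_⟩
      rw [mk_par, mk_eq_of_equiv hab, mk_eq_of_equiv huv]
      simp only [mk_par, add_add_add_comm]

/-- A labelled order is represented by at most one term up to equivalence. -/
theorem Rep.unique {α : Type} {lt : α → α → Prop} {lab : α → B} {s t : SPTerm B}
    {M : Multiset α} (hs : Rep lt lab s M) (ht : Rep lt lab t M)
    (hasymm : ∀ x ∈ M, ∀ y ∈ M, lt x y → ¬ lt y x) : Equiv s t := by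
  induction hs generalizing t with
  | atom a =>
    generalize hM : ({a} : Multiset α) = M at ht
    cases ht with
    | atom b => rw [Multiset.singleton_inj.1 hM]; exact .refl _
    | seq h1 h2 =>
      exact ((singleton_eq_add hM).elim h1.ne_zero h2.ne_zero).elim
    | par h1 h2 =>
      exact ((singleton_eq_add hM).elim h1.ne_zero h2.ne_zero).elim
  | seq h1 h2 hser ih1 ih2 =>
    obtain ⟨u, v, hu, hv, huv⟩ := ht.split_series hasymm rfl h1.ne_zero h2.ne_zero hser
    have e1 := ih1 hu fun x hx y hy => hasymm x (by simp [hx]) y (by simp [hy])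
    have e2 := ih2 hv fun x hx y hy => hasymm x (by simp [hx]) y (by simp [hy])
    exact (e1.seqCongr e2).trans huv.symm
  | par h1 h2 hpar ih1 ih2 =>
    obtain ⟨u, v, hu, hv, huv⟩ := ht.split_parallel rfl h1.ne_zero h2.ne_zero hpar
    have e1 := ih1 hu fun x hx y hy => hasymm x (by simp [hx]) y (by simp [hy])
    have e2 := ih2 hv fun x hx y hy => hasymm x (by simp [hx]) y (by simp [hy])
    exact (e1.parCongr e2).trans huv.symm

end SPTerm

/-! ### Reachability in series-parallel graphs -/

namespace SSG

variable {B : Type}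

/-- Directed reachability. -/
abbrev Reach (G : SSG B) : G.V → G.V → Prop := Relation.ReflTransGen G.Adj

/-- An edge precedes another one if the target of the first reaches the source of the second. -/
def Before (G : SSG B) (e f : G.V × B × G.V) : Prop := G.Reach e.2.2 f.1

/-- Every vertex lies between the source and the sink, and there is a rank function, from `0` at
the source to `1` at the sink, which increases along edges. -/
structure IsRanked (G : SSG B) : Prop where
  source_reach : ∀ v, G.Reach G.s v
  reach_sink : ∀ v, G.Reach v G.z
  exists_rank : ∃ r : G.V → ℚ, r G.s = 0 ∧ r G.z = 1 ∧ ∀ e ∈ G.E, r e.1 < r e.2.2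

theorem Reach.rank_le {G : SSG B} {r : G.V → ℚ} (hr : ∀ e ∈ G.E, r e.1 < r e.2.2) {u v : G.V}
    (h : G.Reach u v) : r u ≤ r v := by
  induction h with
  | refl => exact le_rfl
  | tail _ h ih =>
    obtain ⟨b, hb⟩ := h
    exact ih.trans (hr _ hb).le

theorem IsRanked.not_reach_of_edge {G : SSG B} (h : G.IsRanked) {e : G.V × B × G.V}
    (he : e ∈ G.E) : ¬ G.Reach e.2.2 e.1 := fun h' => by
  obtain ⟨r, -, -, hr⟩ := h.exists_rank
  exact absurd (h'.rank_le hr) (not_le.2 (hr e he))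

theorem IsRanked.before_asymm {G : SSG B} (h : G.IsRanked) {e f : G.V × B × G.V}
    (he : e ∈ G.E) (hf : f ∈ G.E) (hef : G.Before e f) : ¬ G.Before f e := fun hfe =>
  h.not_reach_of_edge he ((hef.tail ⟨f.2.1, hf⟩).trans hfe)

theorem IsRanked.not_reach_source {G : SSG B} (h : G.IsRanked) {e : G.V × B × G.V}
    (he : e ∈ G.E) : ¬ G.Reach e.2.2 G.s := fun h' =>
  h.not_reach_of_edge he (h'.trans (h.source_reach _))

theorem IsRanked.edge_source_ne_sink {G : SSG B} (h : G.IsRanked) {e : G.V × B × G.V}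
    (he : e ∈ G.E) : e.1 ≠ G.z := fun h' =>
  h.not_reach_of_edge he (h' ▸ h.reach_sink _)

/-- A vertex map sending edges to paths preserves reachability. -/
theorem Reach.map {G H : SSG B} (f : G.V → H.V) (hf : ∀ e ∈ G.E, H.Reach (f e.1) (f e.2.2))
    {u v : G.V} (h : G.Reach u v) : H.Reach (f u) (f v) := by
  induction h with
  | refl => exact .refl
  | tail _ h ih =>
    obtain ⟨b, hb⟩ := h
    exact ih.trans (hf _ hb)

theorem edge_reach {G : SSG B} {e : G.V × B × G.V} (he : e ∈ G.E) : G.Reach e.1 e.2.2 :=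
  .single ⟨e.2.1, he⟩

theorem mem_mapEdges {V W : Type} (f : V → W) {E : Multiset (V × B × V)} {e : W × B × W} :
    e ∈ mapEdges f E ↔ ∃ e' ∈ E, (f e'.1, e'.2.1, f e'.2.2) = e := Multiset.mem_map

theorem reach_of_edges_eq {G H : SSG B} {f : G.V → H.V} {E : Multiset (H.V × B × H.V)}
    (hE : H.E = mapEdges f G.E + E) {u v : G.V} (h : G.Reach u v) : H.Reach (f u) (f v) :=
  h.map f fun e he => .single ⟨e.2.1, by
    rw [hE, Multiset.mem_add, mem_mapEdges]; exact .inl ⟨e, he, rfl⟩⟩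

theorem seqInl_reach (G G' : SSG B) {u v : G.V} (h : G.Reach u v) :
    (G.seq G').Reach (seqInl G G' u) (seqInl G G' v) :=
  reach_of_edges_eq (seq_edges G G') h

theorem seqInr_reach (G G' : SSG B) {u v : G'.V} (h : G'.Reach u v) :
    (G.seq G').Reach (seqInr G G' u) (seqInr G G' v) :=
  reach_of_edges_eq ((seq_edges G G').trans (add_comm _ _)) h

theorem parInl_reach (G G' : SSG B) {u v : G.V} (h : G.Reach u v) :
    (G.par G').Reach (parInl G G' u) (parInl G G' v) :=
  reach_of_edges_eq (par_edges G G') h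

theorem parInr_reach (G G' : SSG B) {u v : G'.V} (h : G'.Reach u v) :
    (G.par G').Reach (parInr G G' u) (parInr G G' v) :=
  reach_of_edges_eq ((par_edges G G').trans (add_comm _ _)) h

/-- Extension of a pair of maps to the sequential composition. -/
def seqElim {G G' : SSG B} {X : Type} (f : G.V → X) (g : G'.V → X) : (G.seq G').V → X :=
  Sum.elim (fun u => f u.1) g

theorem seqElim_inl {G G' : SSG B} {X : Type} {f : G.V → X} {g : G'.V → X}
    (h : f G.z = g G'.s) (u : G.V) : seqElim f g (seqInl G G' u) = f u := by
  by_cases hu : u = G.z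
  · subst hu; rw [seqInl, seqEmbed_sink]; exact h.symm
  · rw [seqInl, seqEmbed_of_ne _ _ hu]; rfl

theorem seqElim_inr {G G' : SSG B} {X : Type} {f : G.V → X} {g : G'.V → X} (v : G'.V) :
    seqElim f g (seqInr G G' v) = g v := rfl

/-- Extension of a pair of maps to the parallel composition. -/
def parElim {G G' : SSG B} {X : Type} (f : G.V → X) (g : G'.V → X) : (G.par G').V → X :=
  Sum.elim (fun u => f u.1) g

theorem parElim_inl {G G' : SSG B} {X : Type} {f : G.V → X} {g : G'.V → X}
    (hs : f G.s = g G'.s) (hz : f G.z = g G'.z) (u : G.V) :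
    parElim f g (parInl G G' u) = f u := by
  by_cases hu : u = G.s
  · subst hu; rw [parInl, parEmbed_source]; exact hs.symm
  by_cases hu' : u = G.z
  · subst hu'; rw [parInl, parEmbed_sink]; exact hz.symm
  · rw [parInl, parEmbed_of_ne _ _ hu hu']; rfl

theorem parElim_inr {G G' : SSG B} {X : Type} {f : G.V → X} {g : G'.V → X} (v : G'.V) :
    parElim f g (parInr G G' v) = g v := rfl

theorem seq_forall_edges {G G' : SSG B} {P : (G.seq G').V × B × (G.seq G').V → Prop}
    (h : ∀ e ∈ G.E, P (seqInl G G' e.1, e.2.1, seqInl G G' e.2.2))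
    (h' : ∀ e ∈ G'.E, P (seqInr G G' e.1, e.2.1, seqInr G G' e.2.2)) :
    ∀ e ∈ (G.seq G').E, P e := by
  intro e he
  rw [seq_edges, Multiset.mem_add, mem_mapEdges, mem_mapEdges] at he
  rcases he with ⟨e, he, rfl⟩ | ⟨e, he, rfl⟩
  · exact h e he
  · exact h' e he

theorem par_forall_edges {G G' : SSG B} {P : (G.par G').V × B × (G.par G').V → Prop}
    (h : ∀ e ∈ G.E, P (parInl G G' e.1, e.2.1, parInl G G' e.2.2))
    (h' : ∀ e ∈ G'.E, P (parInr G G' e.1, e.2.1, parInr G G' e.2.2)) :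
    ∀ e ∈ (G.par G').E, P e := by
  intro e he
  rw [par_edges, Multiset.mem_add, mem_mapEdges, mem_mapEdges] at he
  rcases he with ⟨e, he, rfl⟩ | ⟨e, he, rfl⟩
  · exact h e he
  · exact h' e he

theorem seqInl_sink (G G' : SSG B) : seqInl G G' G.z = seqInr G G' G'.s := seqEmbed_sink G G'

theorem seqInl_source (G G' : SSG B) : seqInl G G' G.s = (G.seq G').s :=
  seqEmbed_of_ne G G' G.ne

theorem parInl_source (G G' : SSG B) : parInl G G' G.s = (G.par G').s := parEmbed_source G G'

theorem parInl_sink (G G' : SSG B) : parInl G G' G.z = (G.par G').z := parEmbed_sink G G'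

theorem seqInl_reach_seqInr {G G' : SSG B} (h : G.IsRanked) (h' : G'.IsRanked) (u : G.V)
    (v : G'.V) : (G.seq G').Reach (seqInl G G' u) (seqInr G G' v) :=
  (seqInl_reach G G' (h.reach_sink u)).trans
    (seqInl_sink G G' ▸ seqInr_reach G G' (h'.source_reach v))

theorem IsRanked.single (b : B) : (SSG.single b).IsRanked := by
  have hst : (SSG.single b).Reach false true := .single ⟨b, Multiset.mem_singleton_self _⟩
  refine ⟨fun v => ?_, fun v => ?_, fun v => cond v 1 0, rfl, rfl, ?_⟩
  · cases v
    · exact .refl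
    · exact hst
  · cases v
    · exact hst
    · exact .refl
  · intro e he
    obtain rfl := Multiset.mem_singleton.1 he
    exact zero_lt_one

theorem IsRanked.seq {G G' : SSG B} (h : G.IsRanked) (h' : G'.IsRanked) :
    (G.seq G').IsRanked := by
  obtain ⟨r, hs, hz, hr⟩ := h.exists_rank
  obtain ⟨r', hs', hz', hr'⟩ := h'.exists_rank
  refine ⟨fun w => ?_, fun w => ?_,
    seqElim (fun u => r u / 2) (fun v => 1 / 2 + r' v / 2), ?_, ?_, ?_⟩
  · rw [← seqInl_source]
    rcases seq_vertex_cases G G' w with ⟨u, rfl⟩ | ⟨v, rfl⟩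
    · exact seqInl_reach G G' (h.source_reach u)
    · exact seqInl_reach_seqInr h h' _ v
  · rcases seq_vertex_cases G G' w with ⟨u, rfl⟩ | ⟨v, rfl⟩
    · exact seqInl_reach_seqInr h h' u _
    · exact seqInr_reach G G' (h'.reach_sink v)
  · rw [← seqInl_source, seqElim_inl (by rw [hz, hs']; norm_num), hs]; norm_num
  · change 1 / 2 + r' G'.z / 2 = 1
    rw [hz']; norm_num
  · refine seq_forall_edges (fun e he => ?_) (fun e he => ?_)
    · rw [seqElim_inl (by rw [hz, hs']; norm_num), seqElim_inl (by rw [hz, hs']; norm_num)]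
      linarith [hr e he]
    · rw [seqElim_inr, seqElim_inr]
      linarith [hr' e he]

theorem IsRanked.par {G G' : SSG B} (h : G.IsRanked) (h' : G'.IsRanked) :
    (G.par G').IsRanked := by
  obtain ⟨r, hs, hz, hr⟩ := h.exists_rank
  obtain ⟨r', hs', hz', hr'⟩ := h'.exists_rank
  refine ⟨fun w => ?_, fun w => ?_, parElim r r', hs', hz', ?_⟩
  · rcases par_vertex_cases G G' w with ⟨u, rfl⟩ | ⟨v, rfl⟩
    · exact parInl_source G G' ▸ parInl_reach G G' (h.source_reach u)
    · exact parInr_reach G G' (h'.source_reach v)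
  · rcases par_vertex_cases G G' w with ⟨u, rfl⟩ | ⟨v, rfl⟩
    · exact parInl_sink G G' ▸ parInl_reach G G' (h.reach_sink u)
    · exact parInr_reach G G' (h'.reach_sink v)
  · refine par_forall_edges (fun e he => ?_) (fun e he => ?_)
    · rw [parElim_inl (by rw [hs, hs']) (by rw [hz, hz']),
        parElim_inl (by rw [hs, hs']) (by rw [hz, hz'])]
      exact hr e he
    · exact hr' e he

theorem seqInl_reach_iff {G G' : SSG B} {u v : G.V} :
    (G.seq G').Reach (seqInl G G' u) (seqInl G G' v) ↔ G.Reach u v := by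
  refine ⟨fun hr => ?_, seqInl_reach G G'⟩
  have := Reach.map (H := G) (seqElim id fun _ => G.z) ?_ hr
  · rwa [seqElim_inl rfl, seqElim_inl rfl] at this
  · refine seq_forall_edges (fun e he => ?_) (fun e he => .refl)
    rw [seqElim_inl rfl, seqElim_inl rfl]
    exact edge_reach he

theorem seqInr_reach_iff {G G' : SSG B} {u v : G'.V} :
    (G.seq G').Reach (seqInr G G' u) (seqInr G G' v) ↔ G'.Reach u v := by
  refine ⟨fun hr => ?_, seqInr_reach G G'⟩
  refine Reach.map (H := G') (seqElim (fun _ => G'.s) id) ?_ hr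
  refine seq_forall_edges (fun e he => ?_) (fun e he => edge_reach he)
  rw [seqElim_inl rfl, seqElim_inl rfl]

open Classical in
/-- Collapse of a graph onto the source and the sink of another one. -/
noncomputable def collapse (G H : SSG B) (v : G.V) : H.V := if v = G.z then H.z else H.s

theorem collapse_source (G H : SSG B) : collapse G H G.s = H.s := if_neg G.ne

theorem collapse_sink (G H : SSG B) : collapse G H G.z = H.z := if_pos rfl

theorem collapse_edge_source {G H : SSG B} (h : G.IsRanked) {e : G.V × B × G.V} (he : e ∈ G.E) :
    collapse G H e.1 = H.s := if_neg (h.edge_source_ne_sink he)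

/-- The retraction of a parallel composition onto its first component preserves
reachability. -/
theorem Reach.par_fst {G G' : SSG B} (h : G.IsRanked) (h' : G'.IsRanked) {u v : (G.par G').V}
    (hr : (G.par G').Reach u v) :
    G.Reach (parElim id (collapse G' G) u) (parElim id (collapse G' G) v) := by
  refine Reach.map (H := G) _ ?_ hr
  refine par_forall_edges (fun e he => ?_) (fun e he => ?_)
  · rw [parElim_inl (collapse_source _ _).symm (collapse_sink _ _).symm,
      parElim_inl (collapse_source _ _).symm (collapse_sink _ _).symm]
    exact edge_reach he
  · rw [parElim_inr, parElim_inr, collapse_edge_source h' he]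
    exact h.source_reach _

/-- The retraction of a parallel composition onto its second component preserves
reachability. -/
theorem Reach.par_snd {G G' : SSG B} (h : G.IsRanked) (h' : G'.IsRanked) {u v : (G.par G').V}
    (hr : (G.par G').Reach u v) :
    G'.Reach (parElim (collapse G G') id u) (parElim (collapse G G') id v) := by
  refine Reach.map (H := G') _ ?_ hr
  refine par_forall_edges (fun e he => ?_) (fun e he => edge_reach he)
  rw [parElim_inl (collapse_source _ _) (collapse_sink _ _),
    parElim_inl (collapse_source _ _) (collapse_sink _ _), collapse_edge_source h he]
  exact h'.source_reach _

theorem parInl_reach_iff {G G' : SSG B} (h : G.IsRanked) (h' : G'.IsRanked) {u v : G.V} :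
    (G.par G').Reach (parInl G G' u) (parInl G G' v) ↔ G.Reach u v := by
  refine ⟨fun hr => ?_, parInl_reach G G'⟩
  have := hr.par_fst h h'
  rwa [parElim_inl (collapse_source _ _).symm (collapse_sink _ _).symm,
    parElim_inl (collapse_source _ _).symm (collapse_sink _ _).symm] at this

theorem parInr_reach_iff {G G' : SSG B} (h : G.IsRanked) (h' : G'.IsRanked) {u v : G'.V} :
    (G.par G').Reach (parInr G G' u) (parInr G G' v) ↔ G'.Reach u v :=
  ⟨fun hr => hr.par_snd h h', parInr_reach G G'⟩

theorem not_parInl_reach_parInr {G G' : SSG B} (h : G.IsRanked) (h' : G'.IsRanked)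
    {e : G.V × B × G.V} {f : G'.V × B × G'.V} (he : e ∈ G.E) (hf : f ∈ G'.E) :
    ¬ (G.par G').Reach (parInl G G' e.2.2) (parInr G G' f.1) := by
  intro hr
  have := hr.par_fst h h'
  rw [parElim_inl (collapse_source _ _).symm (collapse_sink _ _).symm, parElim_inr,
    collapse_edge_source h' hf] at this
  exact h.not_reach_source he this

theorem not_parInr_reach_parInl {G G' : SSG B} (h : G.IsRanked) (h' : G'.IsRanked)
    {e : G.V × B × G.V} {f : G'.V × B × G'.V} (he : e ∈ G.E) (hf : f ∈ G'.E) :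
    ¬ (G.par G').Reach (parInr G G' f.2.2) (parInl G G' e.1) := by
  intro hr
  have := hr.par_snd h h'
  rw [parElim_inl (collapse_source _ _) (collapse_sink _ _), parElim_inr,
    collapse_edge_source h he] at this
  exact h'.not_reach_source hf this

theorem reach_iff_of_equiv {G H : SSG B} (f : G.V ≃ H.V) (hE : mapEdges f G.E = H.E)
    {u v : G.V} : H.Reach (f u) (f v) ↔ G.Reach u v := by
  refine ⟨fun h => ?_, reach_of_edges_eq (hE.symm.trans (add_zero _).symm)⟩
  have hE' : mapEdges f.symm H.E = G.E := by
    rw [← hE, mapEdges_mapEdges, Equiv.symm_comp_self]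
    exact Multiset.map_id _
  simpa using reach_of_edges_eq (hE'.symm.trans (add_zero _).symm) h

end SSG

/-! ### Graphs of series-parallel terms -/

namespace SPTerm

variable {B : Type}

/-- The series-parallel graph denoted by a term. -/
def graph : SPTerm B → SSG B
  | .atom b => SSG.single b
  | .seq s t => s.graph.seq t.graph
  | .par s t => s.graph.par t.graph

theorem graph_isRanked : ∀ s : SPTerm B, s.graph.IsRanked
  | .atom b => .single b
  | .seq s t => s.graph_isRanked.seq t.graph_isRanked
  | .par s t => s.graph_isRanked.par t.graph_isRanked

theorem Equiv.graph_iso {s t : SPTerm B} (h : Equiv s t) : s.graph.Iso t.graph := by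
  induction h with
  | refl s => exact .refl _
  | symm _ ih => exact ih.symm
  | trans _ _ ih ih' => exact ih.trans ih'
  | seqCongr _ _ ih ih' => exact ih.seq ih'
  | parCongr _ _ ih ih' => exact ih.par ih'
  | seqAssoc s t u => exact SSG.seq_assoc_iso _ _ _
  | parAssoc s t u => exact SSG.par_assoc_iso _ _ _
  | parComm s t => exact SSG.par_comm_iso _ _

/-- The edges of the graph of a term, ordered by reachability, represent the term. -/
theorem rep_graph (s : SPTerm B) :
    Rep s.graph.Before (fun e => e.2.1) s s.graph.E := by
  induction s with
  | atom b => exact Rep.atom (lab := fun e : Bool × B × Bool => e.2.1) (false, b, true)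
  | seq s t ihs iht =>
    refine Rep.seq (ihs.map (SSG.mapEdge (SSG.seqInl s.graph t.graph)) (fun _ => rfl) ?_)
      (iht.map (SSG.mapEdge (SSG.seqInr s.graph t.graph)) (fun _ => rfl) ?_) ?_
    · exact fun x _ y _ => SSG.seqInl_reach_iff
    · exact fun x _ y _ => SSG.seqInr_reach_iff
    · intro x hx y hy
      obtain ⟨x, -, rfl⟩ := Multiset.mem_map.1 hx
      obtain ⟨y, -, rfl⟩ := Multiset.mem_map.1 hy
      exact SSG.seqInl_reach_seqInr s.graph_isRanked t.graph_isRanked _ _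
  | par s t ihs iht =>
    refine Rep.par (ihs.map (SSG.mapEdge (SSG.parInl s.graph t.graph)) (fun _ => rfl) ?_)
      (iht.map (SSG.mapEdge (SSG.parInr s.graph t.graph)) (fun _ => rfl) ?_) ?_
    · exact fun x _ y _ => SSG.parInl_reach_iff s.graph_isRanked t.graph_isRanked
    · exact fun x _ y _ => SSG.parInr_reach_iff s.graph_isRanked t.graph_isRanked
    · intro x hx y hy
      obtain ⟨x, hx', rfl⟩ := Multiset.mem_map.1 hx
      obtain ⟨y, hy', rfl⟩ := Multiset.mem_map.1 hy
      exact ⟨SSG.not_parInl_reach_parInr s.graph_isRanked t.graph_isRanked hx' hy',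
        SSG.not_parInr_reach_parInl s.graph_isRanked t.graph_isRanked hx' hy'⟩

/-- Terms with isomorphic graphs are equivalent. -/
theorem equiv_of_graph_iso {s t : SPTerm B} (h : s.graph.Iso t.graph) : Equiv s t := by
  obtain ⟨f, hE, -, -⟩ := h
  have hs := (rep_graph s).map (lt' := t.graph.Before) (lab' := fun e => e.2.1)
    (SSG.mapEdge f) (fun _ => rfl) (fun x _ y _ => SSG.reach_iff_of_equiv f hE)
  rw [show s.graph.E.map (SSG.mapEdge f) = t.graph.E from hE] at hs
  exact hs.unique (rep_graph t) fun x hx y hy => t.graph_isRanked.before_asymm hx hy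

end SPTerm

/-! ### Semantics in classes of series-parallel terms -/

namespace SandTree

open SandTreeList SPTerm
open scoped Pointwise

variable {B : Type}

mutual
/-- The semantics of a tree as a set of classes of series-parallel terms. -/
def classSem : SandTree B → Set (Class B)
  | .atom b => {⟦SPTerm.atom b⟧}
  | .or ts => classSemOr ts
  | .and ts => classSemAnd ts
  | .sand ts => classSemSand ts
/-- The union of the semantics of the arguments. -/
def classSemOr : SandTreeList B → Set (Class B)
  | .single t => classSem t
  | .cons t ts => classSem t ∪ classSemOr ts
/-- The pointwise parallel composition of the semantics of the arguments. -/
def classSemAnd : SandTreeList B → Set (Class B)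
  | .single t => classSem t
  | .cons t ts => classSem t + classSemAnd ts
/-- The pointwise sequential composition of the semantics of the arguments. -/
def classSemSand : SandTreeList B → Set (Class B)
  | .single t => classSem t
  | .cons t ts => classSem t * classSemSand ts
end

/-- The graphs of the terms whose class belongs to a given set. -/
def graphs (S : Set (Class B)) : Set (SSG B) :=
  {G | ∃ s : SPTerm B, ⟦s⟧ ∈ S ∧ s.graph.Iso G}

theorem graphs_injective : Function.Injective (graphs (B := B)) := by
  have key : ∀ S S' : Set (Class B), graphs S = graphs S' → S ⊆ S' := by
    intro S S' h q
    induction q using Quotient.inductionOn with | _ s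
    intro hs
    have hG : s.graph ∈ graphs S' := h ▸ ⟨s, hs, .refl _⟩
    obtain ⟨s', hs', hiso⟩ := hG
    rwa [← mk_eq_of_equiv (equiv_of_graph_iso hiso)]
  exact fun S S' h => (key S S' h).antisymm (key S' S h.symm)

theorem graphs_singleton (s : SPTerm B) : graphs {⟦s⟧} = {G | s.graph.Iso G} := by
  ext G
  constructor
  · rintro ⟨s', hs', hG⟩
    exact (equiv_of_mk_eq hs').symm.graph_iso.trans hG
  · exact fun hG => ⟨s, rfl, hG⟩

theorem graphs_union (S S' : Set (Class B)) : graphs (S ∪ S') = graphs S ∪ graphs S' := by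
  ext G
  constructor
  · rintro ⟨s, hs | hs, hG⟩
    · exact .inl ⟨s, hs, hG⟩
    · exact .inr ⟨s, hs, hG⟩
  · rintro (⟨s, hs, hG⟩ | ⟨s, hs, hG⟩)
    · exact ⟨s, .inl hs, hG⟩
    · exact ⟨s, .inr hs, hG⟩

theorem graphs_add (S S' : Set (Class B)) :
    graphs (S + S') = {G | ∃ G1 ∈ graphs S, ∃ G2 ∈ graphs S', (G1.par G2).Iso G} := by
  ext G
  constructor
  · rintro ⟨s, hs, hG⟩
    obtain ⟨p, hp, q, hq, hpq⟩ := Set.mem_add.1 hs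
    induction p using Quotient.inductionOn with | _ u
    induction q using Quotient.inductionOn with | _ v
    exact ⟨u.graph, ⟨u, hp, .refl _⟩, v.graph, ⟨v, hq, .refl _⟩,
      (equiv_of_mk_eq (s := u.par v) hpq).graph_iso.trans hG⟩
  · rintro ⟨G1, ⟨u, hu, h1⟩, G2, ⟨v, hv, h2⟩, hG⟩
    exact ⟨u.par v, Set.add_mem_add hu hv, (h1.par h2).trans hG⟩

theorem graphs_mul (S S' : Set (Class B)) :
    graphs (S * S') = {G | ∃ G1 ∈ graphs S, ∃ G2 ∈ graphs S', (G1.seq G2).Iso G} := by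
  ext G
  constructor
  · rintro ⟨s, hs, hG⟩
    obtain ⟨p, hp, q, hq, hpq⟩ := Set.mem_mul.1 hs
    induction p using Quotient.inductionOn with | _ u
    induction q using Quotient.inductionOn with | _ v
    exact ⟨u.graph, ⟨u, hp, .refl _⟩, v.graph, ⟨v, hq, .refl _⟩,
      (equiv_of_mk_eq (s := u.seq v) hpq).graph_iso.trans hG⟩
  · rintro ⟨G1, ⟨u, hu, h1⟩, G2, ⟨v, hv, h2⟩, hG⟩
    exact ⟨u.seq v, Set.mul_mem_mul hu hv, (h1.seq h2).trans hG⟩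

mutual
theorem sem_eq_graphs : ∀ t : SandTree B, sem t = graphs (classSem t)
  | .atom b => by rw [sem, classSem, graphs_singleton]; rfl
  | .or ts => by rw [sem, classSem, semOr_eq_graphs ts]
  | .and ts => by rw [sem, classSem, semAnd_eq_graphs ts]
  | .sand ts => by rw [sem, classSem, semSand_eq_graphs ts]
theorem semOr_eq_graphs : ∀ ts : SandTreeList B, semOr ts = graphs (classSemOr ts)
  | .single t => by rw [semOr, classSemOr, sem_eq_graphs t]
  | .cons t ts => by rw [semOr, classSemOr, graphs_union, sem_eq_graphs t, semOr_eq_graphs ts]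
theorem semAnd_eq_graphs : ∀ ts : SandTreeList B, semAnd ts = graphs (classSemAnd ts)
  | .single t => by rw [semAnd, classSemAnd, sem_eq_graphs t]
  | .cons t ts => by rw [semAnd, classSemAnd, graphs_add, sem_eq_graphs t, semAnd_eq_graphs ts]
theorem semSand_eq_graphs : ∀ ts : SandTreeList B, semSand ts = graphs (classSemSand ts)
  | .single t => by rw [semSand, classSemSand, sem_eq_graphs t]
  | .cons t ts => by
    rw [semSand, classSemSand, graphs_mul, sem_eq_graphs t, semSand_eq_graphs ts]
end

theorem sem_eq_sem_iff {t t' : SandTree B} : sem t = sem t' ↔ classSem t = classSem t' := by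
  rw [sem_eq_graphs, sem_eq_graphs, graphs_injective.eq_iff]

/-! ### Soundness -/

theorem mem_classSemOr {ts : SandTreeList B} {q : Class B} :
    q ∈ classSemOr ts ↔ ∃ u ∈ ts.toList, q ∈ classSem u := by
  match ts with
  | .single t => simp [classSemOr, toList]
  | .cons t ts => simp [classSemOr, toList, mem_classSemOr (ts := ts)]

theorem coe_classSemAnd (ts : SandTreeList B) : (classSemAnd ts : WithZero (Set (Class B))) =
    (ts.toList.map fun u => (classSem u : WithZero (Set (Class B)))).sum := by
  match ts with
  | .single t => simp [classSemAnd, toList]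
  | .cons t ts => simp [classSemAnd, toList, coe_classSemAnd ts]

theorem classSemAnd_perm {ts ts' : SandTreeList B} (h : ts.toList.Perm ts'.toList) :
    classSemAnd ts = classSemAnd ts' := by
  rw [← WithZero.coe_inj, coe_classSemAnd, coe_classSemAnd]
  exact (h.map _).sum_eq

theorem classSemOr_perm {ts ts' : SandTreeList B} (h : ts.toList.Perm ts'.toList) :
    classSemOr ts = classSemOr ts' := by
  ext q
  simp only [mem_classSemOr, h.mem_iff]

theorem classSemOr_glue_congr {xs : List (SandTree B)} {ys ys' : SandTreeList B}
    (h : classSemOr ys = classSemOr ys') :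
    classSemOr (glue xs ys) = classSemOr (glue xs ys') := by
  induction xs with
  | nil => exact h
  | cons x xs ih => simp only [glue, classSemOr, ih]

theorem classSemAnd_glue_congr {xs : List (SandTree B)} {ys ys' : SandTreeList B}
    (h : classSemAnd ys = classSemAnd ys') :
    classSemAnd (glue xs ys) = classSemAnd (glue xs ys') := by
  induction xs with
  | nil => exact h
  | cons x xs ih => simp only [glue, classSemAnd, ih]

theorem classSemSand_glue_congr {xs : List (SandTree B)} {ys ys' : SandTreeList B}
    (h : classSemSand ys = classSemSand ys') :
    classSemSand (glue xs ys) = classSemSand (glue xs ys') := by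
  induction xs with
  | nil => exact h
  | cons x xs ih => simp only [glue, classSemSand, ih]

theorem snoc_nil : ∀ ys : SandTreeList B, snoc ys [] = ys
  | .single _ => rfl
  | .cons t ts => by rw [snoc, snoc_nil ts]

theorem classSemSand_snoc_cons (z : SandTree B) (zs : List (SandTree B)) :
    ∀ ys : SandTreeList B, classSemSand (snoc ys (z :: zs)) =
      classSemSand ys * classSemSand (ofList z zs)
  | .single t => rfl
  | .cons t ts => by
    simp only [snoc, classSemSand, classSemSand_snoc_cons z zs ts, mul_assoc]

theorem classSemSand_snoc_congr {ys ys' : SandTreeList B} (zs : List (SandTree B))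
    (h : classSemSand ys = classSemSand ys') :
    classSemSand (snoc ys zs) = classSemSand (snoc ys' zs) := by
  cases zs with
  | nil => rwa [snoc_nil, snoc_nil]
  | cons z zs => rw [classSemSand_snoc_cons, classSemSand_snoc_cons, h]

theorem classSemAnd_glue_union (xs : List (SandTree B)) {ys ys₁ ys₂ : SandTreeList B}
    (h : classSemAnd ys = classSemAnd ys₁ ∪ classSemAnd ys₂) :
    classSemAnd (glue xs ys) = classSemAnd (glue xs ys₁) ∪ classSemAnd (glue xs ys₂) := by
  induction xs with
  | nil => exact h
  | cons x xs ih => simp only [glue, classSemAnd, ih, Set.add_union]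

theorem classSemSand_glue_union (xs : List (SandTree B)) {ys ys₁ ys₂ : SandTreeList B}
    (h : classSemSand ys = classSemSand ys₁ ∪ classSemSand ys₂) :
    classSemSand (glue xs ys) = classSemSand (glue xs ys₁) ∪ classSemSand (glue xs ys₂) := by
  induction xs with
  | nil => exact h
  | cons x xs ih => simp only [glue, classSemSand, ih, Set.mul_union]

theorem classSemSand_snoc_union (zs : List (SandTree B)) {ys ys₁ ys₂ : SandTreeList B}
    (h : classSemSand ys = classSemSand ys₁ ∪ classSemSand ys₂) :
    classSemSand (snoc ys zs) = classSemSand (snoc ys₁ zs) ∪ classSemSand (snoc ys₂ zs) := by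
  cases zs with
  | nil => rwa [snoc_nil, snoc_nil, snoc_nil]
  | cons z zs => simp only [classSemSand_snoc_cons, h, Set.union_mul]

theorem classSemAnd_glue_or (xs : List (SandTree B)) : ∀ ys : SandTreeList B,
    classSemAnd (glue xs (.single (.or ys))) =
      classSemOr (SandTreeList.map (fun y => .and (glue xs (.single y))) ys)
  | .single y => by
    rw [SandTreeList.map, classSemOr, classSem]
    exact classSemAnd_glue_congr rfl
  | .cons y ys => by
    rw [SandTreeList.map, classSemOr, classSem, ← classSemAnd_glue_or xs ys]
    exact classSemAnd_glue_union xs rfl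

theorem classSemSand_glue_snoc_or (xs zs : List (SandTree B)) : ∀ ys : SandTreeList B,
    classSemSand (glue xs (snoc (.single (.or ys)) zs)) =
      classSemOr (SandTreeList.map (fun y => .sand (glue xs (snoc (.single y) zs))) ys)
  | .single y => by
    rw [SandTreeList.map, classSemOr, classSem]
    exact classSemSand_glue_congr (classSemSand_snoc_congr zs rfl)
  | .cons y ys => by
    rw [SandTreeList.map, classSemOr, classSem, ← classSemSand_glue_snoc_or xs zs ys]
    exact classSemSand_glue_union xs (classSemSand_snoc_union zs rfl)

theorem toList_ofList (t : SandTree B) (l : List (SandTree B)) :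
    (ofList t l).toList = t :: l := by
  induction l generalizing t with
  | nil => rfl
  | cons u us ih => rw [ofList, toList, ih]

theorem toList_glue (xs : List (SandTree B)) (ys : SandTreeList B) :
    (glue xs ys).toList = xs ++ ys.toList := by
  induction xs with
  | nil => rfl
  | cons x xs ih => rw [glue, toList, ih, List.cons_append]

theorem toList_map (f : SandTree B → SandTree B) : ∀ ys : SandTreeList B,
    (SandTreeList.map f ys).toList = ys.toList.map f
  | .single _ => rfl
  | .cons _ ys => by rw [SandTreeList.map, toList, toList, toList_map f ys, List.map_cons]

mutual
theorem classSem_eq_of_deriv {t u : SandTree B} : DerivSP t u → classSem t = classSem u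
  | .refl _ => rfl
  | .symm h => (classSem_eq_of_deriv h).symm
  | .trans h h' => (classSem_eq_of_deriv h).trans (classSem_eq_of_deriv h')
  | .congrOr h => (classSem_eq_of_derivL h).1
  | .congrAnd h => (classSem_eq_of_derivL h).2.1
  | .congrSand h => (classSem_eq_of_derivL h).2.2
  | .ax1 h => classSemOr_perm h
  | .ax2 h => classSemAnd_perm h
  | .ax3 _ _ => classSemOr_glue_congr rfl
  | .ax4 _ _ => classSemAnd_glue_congr rfl
  | .ax4' _ _ zs => classSemSand_glue_congr (classSemSand_snoc_congr zs rfl)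
  | .ax5 _ => rfl
  | .ax6 _ => rfl
  | .ax6' _ => rfl
  | .ax10 xs ys => classSemAnd_glue_or xs ys
  | .ax10' xs ys zs => classSemSand_glue_snoc_or xs zs ys
  | .ax11 a xs => by
    ext q
    simp only [classSem, mem_classSemOr, toList, toList_ofList, List.mem_cons, or_self_left]
theorem classSem_eq_of_derivL {ts us : SandTreeList B} : DerivSPL ts us →
    classSemOr ts = classSemOr us ∧ classSemAnd ts = classSemAnd us ∧
      classSemSand ts = classSemSand us
  | .single h => ⟨classSem_eq_of_deriv h, classSem_eq_of_deriv h, classSem_eq_of_deriv h⟩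
  | .cons h hs => by
    have h1 := classSem_eq_of_deriv h
    obtain ⟨h2, h3, h4⟩ := classSem_eq_of_derivL hs
    simp only [classSemOr, classSemAnd, classSemSand, h1, h2, h3, h4, and_self]
end

end SandTree

/-! ### Normal forms -/

namespace SPTerm

open SandTreeList

variable {B : Type}

/-- The tree with binary conjunctions corresponding to a term. -/
def toTree : SPTerm B → SandTree B
  | .atom b => .atom b
  | .seq s t => .sand (.cons s.toTree (.single t.toTree))
  | .par s t => .and (.cons s.toTree (.single t.toTree))

theorem classSem_toTree : ∀ s : SPTerm B, s.toTree.classSem = {⟦s⟧}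
  | .atom b => rfl
  | .seq s t => by
    simp only [toTree, SandTree.classSem, SandTree.classSemSand, classSem_toTree s,
      classSem_toTree t, mk_seq, Set.singleton_mul_singleton]
  | .par s t => by
    simp only [toTree, SandTree.classSem, SandTree.classSemAnd, classSem_toTree s,
      classSem_toTree t, mk_par, Set.singleton_add_singleton]

theorem Equiv.deriv {s t : SPTerm B} (h : Equiv s t) : DerivSP s.toTree t.toTree := by
  induction h with
  | refl s => exact .refl _
  | symm _ ih => exact ih.symm
  | trans _ _ ih ih' => exact ih.trans ih'
  | seqCongr _ _ ih ih' => exact .congrSand (.cons ih (.single ih'))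
  | parCongr _ _ ih ih' => exact .congrAnd (.cons ih (.single ih'))
  | seqAssoc s t u =>
    exact (DerivSP.ax4' [] (.cons s.toTree (.single t.toTree)) [u.toTree]).trans
      (DerivSP.ax4' [s.toTree] (.cons t.toTree (.single u.toTree)) []).symm
  | parAssoc s t u =>
    refine (DerivSP.ax2 (ts := .cons (s.par t).toTree (.single u.toTree))
      (ts' := .cons u.toTree (.single (s.par t).toTree)) (List.Perm.swap _ _ _)).trans
      ((DerivSP.ax4 [u.toTree] (.cons s.toTree (.single t.toTree))).trans
        ((DerivSP.ax2 ?_).trans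
          (DerivSP.ax4 [s.toTree] (.cons t.toTree (.single u.toTree))).symm))
    exact (List.perm_append_comm (l₁ := [u.toTree]) (l₂ := [s.toTree, t.toTree]))
  | parComm s t => exact .ax2 (List.Perm.swap _ _ _)

end SPTerm

namespace SandTree

open SandTreeList

variable {B : Type}

theorem derivSPL_refl : ∀ ts : SandTreeList B, DerivSPL ts ts
  | .single t => .single (.refl t)
  | .cons t ts => .cons (.refl t) (derivSPL_refl ts)

/-- The tree is derivably equal to a disjunction of trees without disjunctions. -/
def HasNormalForm (t : SandTree B) : Prop :=
  ∃ ts : SandTreeList B, DerivSP t (.or ts) ∧ ∀ u ∈ ts.toList, ∃ s : SPTerm B, s.toTree = u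

theorem HasNormalForm.of_deriv {t u : SandTree B} (h : HasNormalForm u) (htu : DerivSP t u) :
    HasNormalForm t :=
  let ⟨ts, hts, hs⟩ := h
  ⟨ts, htu.trans hts, hs⟩

theorem hasNormalForm_toTree (s : SPTerm B) : HasNormalForm s.toTree :=
  ⟨.single s.toTree, (DerivSP.ax5 _).symm, fun _ hu => ⟨s, (List.mem_singleton.1 hu).symm⟩⟩

theorem HasNormalForm.or : ∀ {ts : SandTreeList B}, (∀ u ∈ ts.toList, HasNormalForm u) →
    HasNormalForm (.or ts)
  | .single t, h => (h t (List.mem_singleton_self t)).of_deriv (.ax5 t)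
  | .cons t ts, h => by
    obtain ⟨as, hta, has⟩ := h t (by simp [toList])
    obtain ⟨bs, htb, hbs⟩ := HasNormalForm.or (ts := ts) fun u hu => h u (by simp [toList, hu])
    refine ⟨glue bs.toList as, ?_, fun u hu => ?_⟩
    · have h1 : DerivSP (.or (.cons t ts)) (.or (.cons (.or as) (.single (.or bs)))) :=
        (DerivSP.ax3 [t] ts).symm.trans (.congrOr (.cons hta (.single htb)))
      have h2 : DerivSP (.or (.cons (.or as) bs)) (.or (glue bs.toList (.single (.or as)))) := by
        refine .ax1 ?_
        rw [toList_glue]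
        exact (List.perm_append_singleton _ _).symm
      exact h1.trans ((DerivSP.ax3 [.or as] bs).trans (h2.trans (.ax3 _ _)))
    · rw [toList_glue, List.mem_append] at hu
      exact hu.elim (hbs u) (has u)

theorem HasNormalForm.and {t u : SandTree B} (ht : HasNormalForm t) (hu : HasNormalForm u) :
    HasNormalForm (.and (.cons t (.single u))) := by
  obtain ⟨as, hta, has⟩ := ht
  obtain ⟨bs, hub, hbs⟩ := hu
  refine HasNormalForm.of_deriv ?_ (DerivSP.congrAnd (.cons hta (.single hub)))
  refine HasNormalForm.of_deriv (HasNormalForm.or ?_) (DerivSP.ax10 [.or as] bs)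
  rw [toList_map]
  intro y hy
  obtain ⟨v, hv, rfl⟩ := List.mem_map.1 hy
  refine HasNormalForm.of_deriv (HasNormalForm.or ?_)
    ((DerivSP.ax2 (ts := .cons (.or as) (.single v)) (ts' := .cons v (.single (.or as)))
      (List.Perm.swap _ _ _)).trans (DerivSP.ax10 [v] as))
  rw [toList_map]
  intro x hx
  obtain ⟨w, hw, rfl⟩ := List.mem_map.1 hx
  obtain ⟨p, rfl⟩ := hbs v hv
  obtain ⟨q, rfl⟩ := has w hw
  exact hasNormalForm_toTree (p.par q)

theorem HasNormalForm.sand {t u : SandTree B} (ht : HasNormalForm t) (hu : HasNormalForm u) :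
    HasNormalForm (.sand (.cons t (.single u))) := by
  obtain ⟨as, hta, has⟩ := ht
  obtain ⟨bs, hub, hbs⟩ := hu
  refine HasNormalForm.of_deriv ?_ (DerivSP.congrSand (.cons hta (.single hub)))
  refine HasNormalForm.of_deriv (HasNormalForm.or ?_) (DerivSP.ax10' [.or as] bs [])
  rw [toList_map]
  intro y hy
  obtain ⟨v, hv, rfl⟩ := List.mem_map.1 hy
  refine HasNormalForm.of_deriv (HasNormalForm.or ?_) (DerivSP.ax10' [] as [v])
  rw [toList_map]
  intro x hx
  obtain ⟨w, hw, rfl⟩ := List.mem_map.1 hx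
  obtain ⟨p, rfl⟩ := hbs v hv
  obtain ⟨q, rfl⟩ := has w hw
  exact hasNormalForm_toTree (q.seq p)

mutual
theorem hasNormalForm : ∀ t : SandTree B, HasNormalForm t
  | .atom b => hasNormalForm_toTree (.atom b)
  | .or ts => .or (hasNormalForm_of_mem ts)
  | .and ts => hasNormalForm_and ts
  | .sand ts => hasNormalForm_sand ts
theorem hasNormalForm_of_mem : ∀ ts : SandTreeList B, ∀ u ∈ ts.toList, HasNormalForm u
  | .single t, _, hu => List.mem_singleton.1 hu ▸ hasNormalForm t
  | .cons t ts, u, hu =>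
    (List.mem_cons.1 hu).elim (fun h => h ▸ hasNormalForm t) (hasNormalForm_of_mem ts u)
theorem hasNormalForm_and : ∀ ts : SandTreeList B, HasNormalForm (.and ts)
  | .single t => (hasNormalForm t).of_deriv (.ax6 t)
  | .cons t ts =>
    ((hasNormalForm t).and (hasNormalForm_and ts)).of_deriv (DerivSP.ax4 [t] ts).symm
theorem hasNormalForm_sand : ∀ ts : SandTreeList B, HasNormalForm (.sand ts)
  | .single t => (hasNormalForm t).of_deriv (.ax6' t)
  | .cons t ts => by
    have h := DerivSP.ax4' [t] ts []
    rw [snoc_nil, snoc_nil] at h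
    exact ((hasNormalForm t).sand (hasNormalForm_sand ts)).of_deriv h.symm
end

/-! ### Completeness -/

theorem deriv_or_cons_of_mem {t u : SandTree B} {ts : SandTreeList B} (htu : DerivSP t u)
    (hu : u ∈ ts.toList) : DerivSP (.or (.cons t ts)) (.or ts) := by
  obtain ⟨l, l', hl⟩ := List.append_of_mem hu
  have hperm : ts.toList.Perm (u :: (l ++ l')) := hl ▸ List.perm_middle
  have h1 : DerivSP (.or (.cons u ts)) (.or (.cons u (ofList u (l ++ l')))) := by
    refine .ax1 ?_
    rw [toList, toList, toList_ofList]
    exact hperm.cons u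
  have h2 : DerivSP (.or (ofList u (l ++ l'))) (.or ts) :=
    .ax1 (by rw [toList_ofList]; exact hperm.symm)
  exact (DerivSP.congrOr (.cons htu (derivSPL_refl ts))).trans
    (h1.trans ((DerivSP.ax11 u (l ++ l')).trans h2))

theorem deriv_or_glue {xs : List (SandTree B)} {ts : SandTreeList B}
    (h : ∀ x ∈ xs, ∃ u ∈ ts.toList, DerivSP x u) : DerivSP (.or (glue xs ts)) (.or ts) := by
  induction xs with
  | nil => exact .refl _
  | cons x xs ih =>
    obtain ⟨u, hu, hxu⟩ := h x List.mem_cons_self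
    refine (deriv_or_cons_of_mem hxu ?_).trans (ih fun y hy => h y (List.mem_cons_of_mem x hy))
    rw [toList_glue]
    exact List.mem_append_right xs hu

theorem deriv_or_of_forall_exists {ts us : SandTreeList B}
    (h : ∀ t ∈ ts.toList, ∃ u ∈ us.toList, DerivSP t u)
    (h' : ∀ u ∈ us.toList, ∃ t ∈ ts.toList, DerivSP u t) : DerivSP (.or ts) (.or us) := by
  have hperm : DerivSP (.or (glue us.toList ts)) (.or (glue ts.toList us)) := by
    refine .ax1 ?_
    rw [toList_glue, toList_glue]
    exact List.perm_append_comm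
  exact (deriv_or_glue h').symm.trans (hperm.trans (deriv_or_glue h))

theorem exists_deriv_of_classSemOr_subset {ts us : SandTreeList B}
    (hts : ∀ t ∈ ts.toList, ∃ s : SPTerm B, s.toTree = t)
    (hus : ∀ u ∈ us.toList, ∃ s : SPTerm B, s.toTree = u)
    (h : classSemOr ts ⊆ classSemOr us) : ∀ t ∈ ts.toList, ∃ u ∈ us.toList, DerivSP t u := by
  intro t ht
  obtain ⟨s, rfl⟩ := hts t ht
  have hs : ⟦s⟧ ∈ classSemOr us := h (mem_classSemOr.2 ⟨_, ht, by
    rw [SPTerm.classSem_toTree]; exact Set.mem_singleton _⟩)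
  obtain ⟨u, hu, hsu⟩ := mem_classSemOr.1 hs
  obtain ⟨s', rfl⟩ := hus u hu
  rw [SPTerm.classSem_toTree] at hsu
  exact ⟨_, hu, (SPTerm.equiv_of_mk_eq hsu).deriv⟩

theorem deriv_of_classSem_eq {t u : SandTree B} (h : classSem t = classSem u) :
    DerivSP t u := by
  obtain ⟨ts, htd, hts⟩ := hasNormalForm t
  obtain ⟨us, hud, hus⟩ := hasNormalForm u
  have heq : classSemOr ts = classSemOr us :=
    (classSem_eq_of_deriv htd).symm.trans (h.trans (classSem_eq_of_deriv hud))
  exact htd.trans ((deriv_or_of_forall_exists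
    (exists_deriv_of_classSemOr_subset hts hus heq.subset)
    (exists_deriv_of_classSemOr_subset hus hts heq.symm.subset)).trans hud.symm)

end SandTree

/-- Theorem 1: `E_SP` is a complete set of axioms for the SP
semantics: `⟦t⟧ = ⟦t'⟧` iff `t = t'` is a syntactic consequence of `E_SP`. -/
theorem ESP_complete (B : Type) (t t' : SandTree B) : sem t = sem t' ↔ DerivSP t t' := by
  rw [SandTree.sem_eq_sem_iff]
  exact ⟨SandTree.deriv_of_classSem_eq, SandTree.classSem_eq_of_deriv⟩
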